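/- arXiv:2305.03818 — 2 statements merged into one kernel-verified Lean document; each statement's English description precedes it below -/
import Mathlib

section
/- Let m ≥ 1, 2 ≤ ℓ ≤ k and d ≥ 1 be integers such that k·d − k(k−1)/2 < m·(2^ℓ − 1)·(k − ℓ + 1). Then there exist m masses μ_1, …, μ_m on ℝ^d such that there is no collection of k pairwise orthogonal hyperplanes in ℝ^d with the property that any ℓ of the k hyperplanes equipartition every μ_i. -/
open MeasureTheory RealInnerProductSpace

noncomputable section

/-- The closed half-space determined by the hyperplane `{x | ⟪a, x⟫ = b}`:
`true` corresponds to `H⁺ = {x | ⟪a, x⟫ ≥ b}`, `false` to `H⁻ = {x | ⟪a, x⟫ ≤ b}`. -/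
def halfSpace {d : ℕ} (a : EuclideanSpace ℝ (Fin d)) (b : ℝ) (ε : Bool) :
    Set (EuclideanSpace ℝ (Fin d)) :=
  if ε then {x | b ≤ ⟪a, x⟫} else {x | ⟪a, x⟫ ≤ b}

/-- The region `⋂ i ∈ s, H i ^ (ε i)` determined by the hyperplanes indexed by `s`. -/
def region {d k : ℕ} (a : Fin k → EuclideanSpace ℝ (Fin d)) (b : Fin k → ℝ)
    (s : Finset (Fin k)) (ε : Fin k → Bool) : Set (EuclideanSpace ℝ (Fin d)) :=
  ⋂ i ∈ s, halfSpace (a i) (b i) (ε i)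

theorem aux_proj {V Y : Type*} [NormedAddCommGroup V] [NormedSpace ℝ V] [FiniteDimensional ℝ V]
    [NormedAddCommGroup Y] [NormedSpace ℝ Y] (L : V →ₗ[ℝ] Y) :
    ∃ (P : V →ₗ[ℝ] LinearMap.ker L) (C : ℝ), 0 < C ∧ ∀ v, ‖v‖ ≤ C * (‖P v‖ + ‖L v‖) := by
  obtain ⟨P, hP⟩ := (LinearMap.ker L).subtype.exists_leftInverse_of_injective
    (LinearMap.ker L).ker_subtype
  have hinj : LinearMap.ker (P.prod L) = ⊥ := by
    rw [LinearMap.ker_eq_bot']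
    intro v hv
    simp only [LinearMap.prod_apply, Function.prod_apply, Prod.mk_eq_zero] at hv
    have := LinearMap.congr_fun hP ⟨v, hv.2⟩
    simp only [LinearMap.comp_apply, Submodule.subtype_apply, LinearMap.id_apply] at this
    have h0 : (P v : V) = v := congrArg Subtype.val this
    rw [← h0, hv.1]
    rfl
  obtain ⟨K, hK0, hK⟩ := (P.prod L).exists_antilipschitzWith hinj
  refine ⟨P, K, by exact_mod_cast hK0, fun v => ?_⟩
  have := hK.le_mul_dist v 0
  simp only [dist_zero_right, map_zero] at this
  refine this.trans ?_
  gcongr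
  rw [LinearMap.prod_apply, Function.prod_apply, Prod.norm_mk]
  exact max_le (by linarith [norm_nonneg (L v)]) (by linarith [norm_nonneg (P v)])

theorem aux_dim {X F : Type*} [MetricSpace X] [NormedAddCommGroup F] [NormedSpace ℝ F]
    [FiniteDimensional ℝ F] (t : Set X) (g : X → F) (C : ℝ)
    (hg : ∀ x ∈ t, ∀ y ∈ t, dist x y ≤ C * dist (g x) (g y)) :
    dimH t ≤ Module.finrank ℝ F := by
  have h1 : AntilipschitzWith C.toNNReal (fun x : t => g x) := by
    refine AntilipschitzWith.of_le_mul_dist fun x y => ?_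
    refine (hg x x.2 y y.2).trans ?_
    gcongr
    exact Real.le_coe_toNNReal C
  have h2 := h1.le_dimH_image Set.univ
  have h3 := (isometry_subtype_coe (s := t)).dimH_image Set.univ
  rw [Set.image_univ, Subtype.range_coe] at h3
  rw [h3, ← Real.dimH_univ_eq_finrank F]
  exact h2.trans (dimH_mono (Set.subset_univ _))

theorem aux_core {E W Y₁ Y₂ : Type*}
    [NormedAddCommGroup E] [NormedSpace ℝ E] [FiniteDimensional ℝ E]
    [NormedAddCommGroup W] [NormedSpace ℝ W] [FiniteDimensional ℝ W]
    [NormedAddCommGroup Y₁] [NormedSpace ℝ Y₁] [FiniteDimensional ℝ Y₁]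
    [NormedAddCommGroup Y₂] [NormedSpace ℝ Y₂] [FiniteDimensional ℝ Y₂]
    (Z : Set (E × W))
    (hlt : Z.Nonempty → Module.finrank ℝ E < Module.finrank ℝ Y₁ + Module.finrank ℝ Y₂)
    (hZ : ∀ z₀ ∈ Z, ∃ (L₁ : E →ₗ[ℝ] Y₁) (L₂ : W →ₗ[ℝ] Y₂),
      Function.Surjective L₁ ∧ Function.Surjective L₂ ∧
      (∀ ε > 0, ∃ r > 0, ∀ z ∈ Z, ∀ z' ∈ Z, dist z z₀ < r → dist z' z₀ < r →
        ‖L₁ (z.1 - z'.1)‖ ≤ ε * ‖z.1 - z'.1‖) ∧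
      (∃ K, 0 ≤ K ∧ ∀ ε > 0, ∃ r > 0, ∀ z ∈ Z, ∀ z' ∈ Z, dist z z₀ < r → dist z' z₀ < r →
        ‖L₂ (z.2 - z'.2)‖ ≤ K * ‖z.1 - z'.1‖ + ε * ‖z.2 - z'.2‖)) :
    Dense (Prod.snd '' Z)ᶜ := by
  rcases Z.eq_empty_or_nonempty with rfl | hne
  · simp
  have hlt := hlt hne
  apply dense_compl_of_dimH_lt_finrank
  refine (LipschitzWith.prod_snd.dimH_image_le Z).trans_lt ?_
  by_contra hcon
  push Not at hcon
  have hW : 0 < Module.finrank ℝ W := by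
    obtain ⟨z₀, hz₀⟩ := hne
    obtain ⟨L₁, L₂, s1, s2, -⟩ := hZ z₀ hz₀
    have e1 := LinearMap.finrank_range_add_finrank_ker L₁
    have e2 := LinearMap.finrank_range_add_finrank_ker L₂
    rw [LinearMap.range_eq_top.2 s1, finrank_top] at e1
    rw [LinearMap.range_eq_top.2 s2, finrank_top] at e2
    omega
  have hlt' : ((Module.finrank ℝ W - 1 : ℕ) : ENNReal) < dimH Z :=
    lt_of_lt_of_le (by exact_mod_cast Nat.sub_lt hW one_pos) hcon
  obtain ⟨z₀, hz₀, hbig⟩ := exists_mem_nhdsWithin_lt_dimH_of_lt_dimH hlt'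
  obtain ⟨L₁, L₂, s1, s2, h1, K, hK, h2⟩ := hZ z₀ hz₀
  have e1 := LinearMap.finrank_range_add_finrank_ker L₁
  have e2 := LinearMap.finrank_range_add_finrank_ker L₂
  rw [LinearMap.range_eq_top.2 s1, finrank_top] at e1
  rw [LinearMap.range_eq_top.2 s2, finrank_top] at e2
  obtain ⟨P₁, C₁, hC₁, hP₁⟩ := aux_proj L₁
  obtain ⟨P₂, C₂, hC₂, hP₂⟩ := aux_proj L₂
  obtain ⟨r₁, hr₁, h1⟩ := h1 (1 / (2 * C₁)) (by positivity)
  obtain ⟨r₂, hr₂, h2⟩ := h2 (1 / (2 * C₂)) (by positivity)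
  have hmem : Z ∩ Metric.ball z₀ (min r₁ r₂) ∈ nhdsWithin z₀ Z :=
    Filter.inter_mem self_mem_nhdsWithin
      (mem_nhdsWithin_of_mem_nhds (Metric.ball_mem_nhds _ (lt_min hr₁ hr₂)))
  have hb := hbig _ hmem
  have hle := aux_dim (Z ∩ Metric.ball z₀ (min r₁ r₂))
    (fun z => (P₁ z.1, P₂ z.2)) (2 * C₁ + (2 * C₂ + 2 * C₂ * K * (2 * C₁))) ?_
  · rw [Module.finrank_prod] at hle
    have := hb.trans_le hle
    norm_cast at this
    omega
  · rintro z ⟨hz, hzr⟩ z' ⟨hz', hzr'⟩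
    rw [Metric.mem_ball, lt_min_iff] at hzr hzr'
    have a1 := h1 z hz z' hz' hzr.1 hzr'.1
    have a2 := h2 z hz z' hz' hzr.2 hzr'.2
    have b1 := hP₁ (z.1 - z'.1)
    have b2 := hP₂ (z.2 - z'.2)
    rw [Prod.dist_eq, Prod.dist_eq, dist_eq_norm, dist_eq_norm, dist_eq_norm, dist_eq_norm,
      ← map_sub, ← map_sub]
    set x := ‖z.1 - z'.1‖
    set y := ‖z.2 - z'.2‖
    set p := ‖P₁ (z.1 - z'.1)‖
    set q := ‖P₂ (z.2 - z'.2)‖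
    set M := max p q
    have hp : p ≤ M := le_max_left _ _
    have hq : q ≤ M := le_max_right _ _
    have hM : 0 ≤ M := (norm_nonneg _).trans hp
    have c1 : C₁ * ‖L₁ (z.1 - z'.1)‖ ≤ x / 2 := by
      calc _ ≤ C₁ * (1 / (2 * C₁) * x) := by gcongr
        _ = _ := by field_simp
    have c2 : C₂ * ‖L₂ (z.2 - z'.2)‖ ≤ C₂ * K * x + y / 2 := by
      calc _ ≤ C₂ * (K * x + 1 / (2 * C₂) * y) := by gcongr
        _ = _ := by field_simp
    have d1 : x ≤ 2 * C₁ * M := by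
      have : C₁ * p ≤ C₁ * M := by gcongr
      nlinarith
    have d2 : y ≤ (2 * C₂ + 2 * C₂ * K * (2 * C₁)) * M := by
      have : C₂ * q ≤ C₂ * M := by gcongr
      have : C₂ * K * x ≤ C₂ * K * (2 * C₁ * M) := by gcongr
      nlinarith
    have e : 0 ≤ 2 * C₁ * M := by positivity
    have e' : 0 ≤ (2 * C₂ + 2 * C₂ * K * (2 * C₁)) * M := by positivity
    apply max_le <;> linarith

theorem aux_slab {d : ℕ} (hd : 1 ≤ d) (a : EuclideanSpace ℝ (Fin d)) (ha : ‖a‖ = 1) (b δ : ℝ)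
    (hδ : 0 ≤ δ) (p : EuclideanSpace ℝ (Fin d)) :
    volume.real (Metric.ball p (1 / 2) ∩ {x | |⟪a, x⟫ - b| ≤ δ}) ≤ 2 * δ := by
  let i0 : Fin d := ⟨0, hd⟩
  obtain ⟨B, hB⟩ := Orthonormal.exists_orthonormalBasis_extension_of_card_eq (𝕜 := ℝ)
    (E := EuclideanSpace ℝ (Fin d)) (ι := Fin d) (by simp) (v := fun _ => a) (s := {i0})
    (by
      constructor
      · intro i; simpa using ha
      · intro i j hij; exact absurd (Subsingleton.elim i j) hij)
  have hB0 : B i0 = a := hB i0 rfl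
  let f : EuclideanSpace ℝ (Fin d) → (Fin d → ℝ) := fun x => WithLp.ofLp (B.repr x)
  have hf : MeasurePreserving f volume volume :=
    (EuclideanSpace.volume_preserving_symm_measurableEquiv_toLp (Fin d)).comp
      (B.measurePreserving_repr)
  have hfi : ∀ x i, f x i = ⟪B i, x⟫ := fun x i => B.repr_apply_apply x i
  let q := f p
  let lo : Fin d → ℝ := fun i => if i = i0 then b - δ else q i - 1 / 2
  let hi : Fin d → ℝ := fun i => if i = i0 then b + δ else q i + 1 / 2
  have hsub : Metric.ball p (1 / 2) ∩ {x | |⟪a, x⟫ - b| ≤ δ} ⊆ f ⁻¹' Set.Icc lo hi := by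
    rintro x ⟨hx1, hx2⟩
    rw [Set.mem_preimage, Set.mem_Icc, Pi.le_def, Pi.le_def, ← forall_and]
    intro i
    by_cases h : i = i0
    · subst h
      simp only [lo, hi, if_true, hfi, hB0]
      have := abs_le.1 (show |⟪a, x⟫ - b| ≤ δ from hx2)
      constructor <;> linarith [this.1, this.2]
    · simp only [lo, hi, if_neg h, hfi, q]
      have h1 : |⟪B i, x - p⟫| ≤ 1 / 2 := by
        refine (abs_real_inner_le_norm _ _).trans ?_
        rw [B.norm_eq_one, one_mul, ← dist_eq_norm]
        exact (Metric.mem_ball.1 hx1).le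
      rw [inner_sub_right] at h1
      have := abs_le.1 h1
      constructor <;> linarith [this.1, this.2]
  have hvol : volume (f ⁻¹' Set.Icc lo hi) = ENNReal.ofReal (2 * δ) := by
    rw [hf.measure_preimage measurableSet_Icc.nullMeasurableSet, Real.volume_Icc_pi,
      Finset.prod_eq_single i0]
    · have : hi i0 - lo i0 = 2 * δ := by simp only [lo, hi, if_true]; ring
      rw [this]
    · intro i _ h
      simp [lo, hi, h]; norm_num
    · simp
  rw [Measure.real]
  refine ENNReal.toReal_le_of_le_ofReal (by positivity) ?_
  rw [← hvol]
  exact measure_mono hsub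

/-- Sign of a Boolean. -/
def sg (b : Bool) : ℝ := if b then 1 else -1

theorem abs_sg (b : Bool) : |sg b| = 1 := by cases b <;> simp [sg]

/-- The sign pattern of a point. -/
def pat {d k : ℕ} (a : Fin k → EuclideanSpace ℝ (Fin d)) (b : Fin k → ℝ)
    (x : EuclideanSpace ℝ (Fin d)) (j : Fin k) : Bool := decide (b j ≤ ⟪a j, x⟫)

/-- Product of signs over `J`. -/
def chi {d k : ℕ} (a : Fin k → EuclideanSpace ℝ (Fin d)) (b : Fin k → ℝ)
    (J : Finset (Fin k)) (x : EuclideanSpace ℝ (Fin d)) : ℝ := ∏ j ∈ J, sg (pat a b x j)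

theorem abs_chi {d k : ℕ} (a : Fin k → EuclideanSpace ℝ (Fin d)) (b : Fin k → ℝ)
    (J : Finset (Fin k)) (x : EuclideanSpace ℝ (Fin d)) : |chi a b J x| = 1 := by
  rw [chi, Finset.abs_prod]
  exact Finset.prod_eq_one fun j _ => abs_sg _

theorem measurable_pat {d k : ℕ} (a : Fin k → EuclideanSpace ℝ (Fin d)) (b : Fin k → ℝ)
    (j : Fin k) : Measurable (fun x => pat a b x j) := by
  apply measurable_to_bool
  have : (fun x => pat a b x j) ⁻¹' {true} = {x | b j ≤ ⟪a j, x⟫} := by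
    ext x; simp [pat]
  rw [this]
  exact measurableSet_le measurable_const (by fun_prop)

theorem measurable_chi {d k : ℕ} (a : Fin k → EuclideanSpace ℝ (Fin d)) (b : Fin k → ℝ)
    (J : Finset (Fin k)) : Measurable (chi a b J) := by
  unfold chi
  refine Finset.measurable_fun_prod _ fun j _ => ?_
  exact (measurable_of_countable sg).comp (measurable_pat a b j)

theorem integrable_chi {d k : ℕ} (a : Fin k → EuclideanSpace ℝ (Fin d)) (b : Fin k → ℝ)
    (J : Finset (Fin k)) (μ : Measure (EuclideanSpace ℝ (Fin d))) [IsFiniteMeasure μ] :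
    Integrable (chi a b J) μ :=
  Integrable.of_bound (measurable_chi a b J).aestronglyMeasurable 1
    (Filter.Eventually.of_forall fun x => by rw [Real.norm_eq_abs, abs_chi])

/-- The matrix of moments. -/
def mom {d k : ℕ} (a : Fin k → EuclideanSpace ℝ (Fin d)) (b : Fin k → ℝ)
    (J : Finset (Fin k)) (p : EuclideanSpace ℝ (Fin d)) : ℝ :=
  ∫ x in Metric.ball p (1 / 2), chi a b J x

instance finBall {d : ℕ} (p : EuclideanSpace ℝ (Fin d)) :
    IsFiniteMeasure (volume.restrict (Metric.ball p (1 / 2))) :=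
  ⟨by simpa using measure_ball_lt_top⟩

theorem mom_lip {d k : ℕ} (hd : 1 ≤ d) (J : Finset (Fin k)) (p : EuclideanSpace ℝ (Fin d)) :
    ∃ K : ℝ, 0 ≤ K ∧ ∀ (a a' : Fin k → EuclideanSpace ℝ (Fin d)) (b b' : Fin k → ℝ),
      (∀ i, ‖a i‖ = 1) →
      |mom a b J p - mom a' b' J p| ≤ K * ‖((a, b) : (_ × _)) - (a', b')‖ := by
  refine ⟨4 * k * (‖p‖ + 2), by positivity, fun a a' b b' ha => ?_⟩
  set t := ‖((a, b) : (_ × _)) - (a', b')‖ with ht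
  have ht0 : 0 ≤ t := norm_nonneg _
  have hta : ∀ j, ‖a j - a' j‖ ≤ t := fun j =>
    (norm_le_pi_norm (a - a') j).trans (le_max_left _ _)
  have htb : ∀ j, |b j - b' j| ≤ t := fun j =>
    (norm_le_pi_norm (b - b') j).trans (le_max_right _ _)
  set δ := (‖p‖ + 2) * t with hδ
  have hδ0 : 0 ≤ δ := by positivity
  let D : Fin k → Set (EuclideanSpace ℝ (Fin d)) := fun j => {x | |⟪a j, x⟫ - b j| ≤ δ}
  have hDm : ∀ j, MeasurableSet (D j) := fun j =>
    measurableSet_le (by fun_prop) measurable_const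
  have key : ∀ x ∈ Metric.ball p (1 / 2),
      ‖chi a b J x - chi a' b' J x‖ ≤ ∑ j, (D j).indicator (fun _ => (2 : ℝ)) x := by
    intro x hx
    have hxn : ‖x‖ ≤ ‖p‖ + 1 := by
      have := norm_le_norm_add_norm_sub' x p
      rw [Metric.mem_ball, dist_eq_norm] at hx
      linarith
    have hnn : ∀ j ∈ Finset.univ, 0 ≤ (D j).indicator (fun _ => (2 : ℝ)) x := fun j _ =>
      Set.indicator_nonneg (fun _ _ => by norm_num) x
    by_cases hall : ∀ j, pat a b x j = pat a' b' x j
    · have : chi a b J x = chi a' b' J x := by simp only [chi, hall]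
      rw [this, sub_self, norm_zero]
      exact Finset.sum_nonneg hnn
    · push Not at hall
      obtain ⟨j, hj⟩ := hall
      have hxD : x ∈ D j := by
        have e : |(⟪a j, x⟫ - b j) - (⟪a' j, x⟫ - b' j)| ≤ δ := by
          have : (⟪a j, x⟫ - b j) - (⟪a' j, x⟫ - b' j) = ⟪a j - a' j, x⟫ - (b j - b' j) := by
            rw [inner_sub_left]; ring
          rw [this]
          refine (abs_sub _ _).trans ?_
          have h1 := abs_real_inner_le_norm (a j - a' j) x
          have h2 : ‖a j - a' j‖ * ‖x‖ ≤ t * (‖p‖ + 1) :=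
            mul_le_mul (hta j) hxn (norm_nonneg _) ht0
          have := htb j
          rw [hδ]; linarith
        change |⟪a j, x⟫ - b j| ≤ δ
        simp only [pat, ne_eq, decide_eq_decide] at hj
        rw [abs_le] at e ⊢
        by_cases h1 : b j ≤ ⟪a j, x⟫
        · have h2 : ¬ b' j ≤ ⟪a' j, x⟫ := fun h2 => hj ⟨fun _ => h2, fun _ => h1⟩
          constructor <;> linarith [e.1, e.2]
        · have h2 : b' j ≤ ⟪a' j, x⟫ := by
            by_contra h2; exact hj ⟨fun h => absurd h h1, fun h => absurd h h2⟩
          constructor <;> linarith [e.1, e.2]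
      calc ‖chi a b J x - chi a' b' J x‖ ≤ |chi a b J x| + |chi a' b' J x| := abs_sub _ _
        _ = (D j).indicator (fun _ => (2 : ℝ)) x := by
          rw [abs_chi, abs_chi, Set.indicator_of_mem hxD]; norm_num
        _ ≤ _ := Finset.single_le_sum hnn (Finset.mem_univ j)
  unfold mom
  rw [← integral_sub (integrable_chi _ _ _ _) (integrable_chi _ _ _ _), ← Real.norm_eq_abs]
  have hInt : ∀ j ∈ Finset.univ, Integrable ((D j).indicator (fun _ => (2 : ℝ)))
      (volume.restrict (Metric.ball p (1 / 2))) := fun j _ =>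
    (integrable_const _).indicator (hDm j)
  calc _ ≤ ∫ x in Metric.ball p (1 / 2), ∑ j, (D j).indicator (fun _ => (2 : ℝ)) x := by
        refine norm_integral_le_of_norm_le (integrable_finsetSum _ hInt) ?_
        exact (ae_restrict_iff' measurableSet_ball).2 (Filter.Eventually.of_forall key)
    _ = ∑ j, volume.real (Metric.ball p (1 / 2) ∩ D j) * 2 := by
        rw [integral_finsetSum _ hInt]
        refine Finset.sum_congr rfl fun j _ => ?_
        rw [integral_indicator (hDm j), setIntegral_const, measureReal_restrict_apply (hDm j),
          Set.inter_comm, smul_eq_mul]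
    _ ≤ ∑ j : Fin k, 2 * δ * 2 := by
        gcongr with j
        exact aux_slab hd (a j) (ha j) (b j) δ hδ0 p
    _ = _ := by simp [hδ]; ring

theorem char_orth {k : ℕ} (J J' : Finset (Fin k)) :
    ∑ σ : Fin k → Bool, (∏ j ∈ J, sg (σ j)) * (∏ j ∈ J', sg (σ j)) =
      if J = J' then 2 ^ k else 0 := by
  have h1 : ∀ σ : Fin k → Bool, (∏ j ∈ J, sg (σ j)) * (∏ j ∈ J', sg (σ j)) =
      ∏ j, (if j ∈ J then sg (σ j) else 1) * (if j ∈ J' then sg (σ j) else 1) := by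
    intro σ
    rw [Finset.prod_mul_distrib, Finset.prod_ite_mem, Finset.prod_ite_mem]
    simp
  simp_rw [h1]
  rw [← Fintype.prod_sum (fun j s => (if j ∈ J then sg s else 1) * (if j ∈ J' then sg s else 1))]
  split_ifs with h
  · subst h
    have : ∀ j : Fin k, ∑ s : Bool, (if j ∈ J then sg s else 1) * (if j ∈ J then sg s else 1)
        = 2 := by
      intro j
      by_cases hj : j ∈ J <;> simp [hj, sg] <;> norm_num
    rw [Finset.prod_congr rfl (fun j _ => this j)]
    simp
  · have : ∃ j, ¬ (j ∈ J ↔ j ∈ J') := by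
      by_contra hc; push Not at hc; exact h (Finset.ext hc)
    obtain ⟨j, hj⟩ := this
    apply Finset.prod_eq_zero (Finset.mem_univ j)
    by_cases h1 : j ∈ J <;> by_cases h2 : j ∈ J' <;> simp_all [sg]

theorem ball_vol_pos {d : ℕ} (p : EuclideanSpace ℝ (Fin d)) :
    0 < volume.real (Metric.ball p (1 / 2)) :=
  ENNReal.toReal_pos (Metric.measure_ball_pos _ _ (by norm_num)).ne' measure_ball_lt_top.ne

theorem mom_const {d k : ℕ} (a : Fin k → EuclideanSpace ℝ (Fin d)) (b : Fin k → ℝ)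
    (J : Finset (Fin k)) (p : EuclideanSpace ℝ (Fin d)) (σ : Fin k → Bool)
    (h : ∀ x ∈ Metric.ball p (1 / 2), ∀ j ∈ J, pat a b x j = σ j) :
    mom a b J p = volume.real (Metric.ball p (1 / 2)) * ∏ j ∈ J, sg (σ j) := by
  unfold mom
  rw [setIntegral_congr_fun (g := fun _ => ∏ j ∈ J, sg (σ j)) measurableSet_ball]
  · rw [setIntegral_const, smul_eq_mul]
  · intro x hx
    exact Finset.prod_congr rfl fun j hj => by rw [h x hx j hj]

theorem abs_mom_le {d k : ℕ} (a : Fin k → EuclideanSpace ℝ (Fin d)) (b : Fin k → ℝ)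
    (J : Finset (Fin k)) (p : EuclideanSpace ℝ (Fin d)) :
    |mom a b J p| ≤ volume.real (Metric.ball p (1 / 2)) := by
  unfold mom
  rw [← Real.norm_eq_abs]
  have := norm_setIntegral_le_of_norm_le_const (μ := volume) (s := Metric.ball p (1 / 2))
    (f := chi a b J) (C := 1) measure_ball_lt_top
    (fun x _ => by rw [Real.norm_eq_abs, abs_chi])
  simpa using this

theorem mom_surj {d k : ℕ} (t : Finset (EuclideanSpace ℝ (Fin d)))
    (ht : ∀ x ∈ Metric.closedBall (0 : EuclideanSpace ℝ (Fin d)) (2 * k), ∃ p ∈ t,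
      dist x p < 1 / 2)
    (a : Fin k → EuclideanSpace ℝ (Fin d)) (b : Fin k → ℝ)
    (ha : ∀ i j, ⟪a i, a j⟫ = if i = j then (1 : ℝ) else 0) (hb : ∀ j, |b j| ≤ 1)
    (y : Finset (Fin k) → ℝ) :
    ∃ w : t → ℝ, ∀ J, ∑ p, w p * mom a b J p = y J := by
  have hna : ∀ i, ‖a i‖ = 1 := fun i => by
    have := ha i i
    rw [real_inner_self_eq_norm_sq, if_pos rfl] at this
    nlinarith [norm_nonneg (a i)]
  have hpt : ∀ σ : Fin k → Bool, ∃ p : t, ∀ J, mom a b J p =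
      volume.real (Metric.ball (p : EuclideanSpace ℝ (Fin d)) (1 / 2)) * ∏ j ∈ J, sg (σ j) := by
    intro σ
    set q := ∑ j, (b j + sg (σ j)) • a j with hq
    have hqn : ‖q‖ ≤ 2 * k := by
      calc ‖q‖ ≤ ∑ j : Fin k, (2 : ℝ) := by
            refine norm_sum_le_of_le _ fun j _ => ?_
            rw [norm_smul, hna, mul_one, Real.norm_eq_abs]
            refine (abs_add_le _ _).trans ?_
            rw [abs_sg]; linarith [hb j]
        _ = 2 * k := by simp; ring
    obtain ⟨p, hpt, hp⟩ := ht q (by simpa using hqn)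
    refine ⟨⟨p, hpt⟩, fun J => mom_const a b J p σ fun x hx j _ => ?_⟩
    have h1 : ⟪a j, q⟫ = b j + sg (σ j) := by
      rw [hq, inner_sum]
      simp [inner_smul_right, ha]
    have h2 : |⟪a j, x - q⟫| < 1 := by
      refine (abs_real_inner_le_norm _ _).trans_lt ?_
      rw [hna, one_mul, ← dist_eq_norm]
      have := dist_triangle x p q
      rw [dist_comm p q] at this
      have h3 := Metric.mem_ball.1 hx
      linarith
    rw [inner_sub_right, h1, abs_lt] at h2
    unfold pat
    cases hσ : σ j
    · simp only [hσ, sg] at h2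
      simp at h2 ⊢
      linarith [h2.2]
    · simp only [hσ, sg] at h2
      simp at h2 ⊢
      linarith [h2.1]
  choose P hP using hpt
  let V : t → ℝ := fun p => volume.real (Metric.ball (p : EuclideanSpace ℝ (Fin d)) (1 / 2))
  have hV : ∀ p, V p ≠ 0 := fun p => (ball_vol_pos _).ne'
  let u : (Fin k → Bool) → ℝ := fun σ =>
    (∑ J', y J' * ∏ j ∈ J', sg (σ j)) / (2 ^ k * V (P σ))
  refine ⟨fun p => ∑ σ, if P σ = p then u σ else 0, fun J => ?_⟩
  calc _ = ∑ σ, u σ * mom a b J (P σ) := by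
        simp_rw [Finset.sum_mul]
        rw [Finset.sum_comm]
        refine Finset.sum_congr rfl fun σ _ => ?_
        simp [ite_mul]
    _ = ∑ σ : Fin k → Bool, ∑ J', y J' / 2 ^ k * ((∏ j ∈ J', sg (σ j)) * ∏ j ∈ J, sg (σ j)) := by
        refine Finset.sum_congr rfl fun σ _ => ?_
        rw [hP]
        change u σ * (V (P σ) * _) = _
        simp only [u]
        have := hV (P σ)
        rw [Finset.sum_div, Finset.sum_mul]
        refine Finset.sum_congr rfl fun J' _ => ?_
        field_simp
    _ = y J := by
        rw [Finset.sum_comm]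
        simp_rw [← Finset.mul_sum, char_orth]
        simp

theorem ae_ne {d : ℕ} (a : EuclideanSpace ℝ (Fin d)) (ha : a ≠ 0) (b : ℝ) :
    ∀ᵐ x : EuclideanSpace ℝ (Fin d), ⟪a, x⟫ ≠ b := by
  have hd : 1 ≤ d := by
    rcases Nat.eq_zero_or_pos d with rfl | h
    · exact absurd (Subsingleton.elim a 0) ha
    · exact h
  have hn : ‖a‖ ≠ 0 := norm_ne_zero_iff.2 ha
  rw [ae_iff]
  have hS : ∀ p : EuclideanSpace ℝ (Fin d),
      volume (Metric.ball p (1 / 2) ∩ {x | ⟪a, x⟫ = b}) = 0 := by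
    intro p
    have h1 := aux_slab hd (‖a‖⁻¹ • a) (by rw [norm_smul, norm_inv, norm_norm]; field_simp)
      (‖a‖⁻¹ * b) 0 le_rfl p
    have h2 : {x : EuclideanSpace ℝ (Fin d) | ⟪a, x⟫ = b} =
        {x | |⟪‖a‖⁻¹ • a, x⟫ - ‖a‖⁻¹ * b| ≤ 0} := by
      ext x
      simp only [Set.mem_setOf_eq, inner_smul_left, abs_nonpos_iff]
      rw [sub_eq_zero]
      simp [hn]
    rw [h2]
    rw [mul_zero] at h1
    have h3 := le_antisymm h1 measureReal_nonneg
    rw [measureReal_eq_zero_iff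
      ((measure_mono Set.inter_subset_left).trans_lt measure_ball_lt_top).ne] at h3
    exact h3
  simp only [ne_eq, not_not]
  refine measure_null_of_locally_null _ fun x _ => ?_
  refine ⟨Metric.ball x (1 / 2) ∩ {x | ⟪a, x⟫ = b}, ?_, hS x⟩
  rw [Set.inter_comm]
  exact inter_mem_nhdsWithin _ (Metric.ball_mem_nhds _ (by norm_num))

theorem equi_chi {d k ℓ : ℕ} (μ : Measure (EuclideanSpace ℝ (Fin d))) [IsFiniteMeasure μ]
    (hμ : μ ≪ volume) (a : Fin k → EuclideanSpace ℝ (Fin d)) (b : Fin k → ℝ)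
    (ha : ∀ i, a i ≠ 0) (s J : Finset (Fin k)) (hJs : J ⊆ s) (hJ : J.Nonempty)
    (h : ∀ ε : Fin k → Bool, μ (region a b s ε) = μ Set.univ / 2 ^ ℓ) :
    ∫ x, chi a b J x ∂μ = 0 := by
  let g : (s → Bool) → ℝ := fun ε => ∏ i : s, if (i : Fin k) ∈ J then sg (ε i) else 1
  let pt : EuclideanSpace ℝ (Fin d) → (s → Bool) := fun x i => pat a b x i
  have hpt : Measurable pt := measurable_pi_lambda _ fun i => measurable_pat a b i
  have hchi : ∀ x, chi a b J x = g (pt x) := by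
    intro x
    simp only [chi, g, pt]
    rw [Finset.prod_coe_sort s (fun i => if i ∈ J then sg (pat a b x i) else 1),
      Finset.prod_ite_mem, Finset.inter_eq_right.2 hJs]
  have hcell : ∀ ε : s → Bool, μ.real (pt ⁻¹' {ε}) = μ.real Set.univ / 2 ^ ℓ := by
    intro ε
    let ε' : Fin k → Bool := fun j => if h : j ∈ s then ε ⟨j, h⟩ else true
    have hae : pt ⁻¹' {ε} =ᵐ[μ] region a b s ε' := by
      have h1 : ∀ᵐ x ∂μ, ∀ i, ⟪a i, x⟫ ≠ b i :=
        ae_all_iff.2 fun i => hμ.ae_le (ae_ne (a i) (ha i) (b i))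
      filter_upwards [h1] with x hx
      apply propext
      change pt x = ε ↔ x ∈ region a b s ε'
      simp only [region, Set.mem_iInter, funext_iff, pt, Subtype.forall]
      refine forall_congr' fun i => forall_congr' fun hi => ?_
      simp only [ε', dif_pos hi, halfSpace, pat]
      have hxi := hx i
      cases ε ⟨i, hi⟩
      · simp only [decide_eq_false_iff_not, not_le, Bool.false_eq_true, if_false,
          Set.mem_setOf_eq]
        exact ⟨le_of_lt, fun h => lt_of_le_of_ne h hxi⟩
      · simp
    rw [measureReal_congr hae, Measure.real, h, ENNReal.toReal_div]
    simp [Measure.real]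
  have hg0 : ∑ ε, g ε = 0 := by
    simp only [g]
    rw [← Fintype.prod_sum (fun (i : s) e => if (i : Fin k) ∈ J then sg e else 1)]
    obtain ⟨j, hj⟩ := hJ
    apply Finset.prod_eq_zero (Finset.mem_univ ⟨j, hJs hj⟩)
    simp [hj, sg]
  simp_rw [hchi]
  rw [← integral_map (φ := pt) (f := g) hpt.aemeasurable
    (measurable_of_countable g).aestronglyMeasurable]
  rw [integral_fintype .of_finite]
  have : ∀ ε, (μ.map pt).real {ε} = μ.real Set.univ / 2 ^ ℓ := fun ε => by
    rw [← hcell ε, map_measureReal_apply hpt (measurableSet_singleton _)]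
  simp_rw [this, smul_eq_mul, ← Finset.mul_sum, hg0, mul_zero]

/-- The mass with weights `w` on the balls. -/
def mass {d : ℕ} (t : Finset (EuclideanSpace ℝ (Fin d))) (w : t → ℝ) :
    Measure (EuclideanSpace ℝ (Fin d)) :=
  ∑ p : t, ENNReal.ofReal (w p) • volume.restrict (Metric.ball (p : EuclideanSpace ℝ (Fin d)) (1 / 2))

theorem mass_fin {d : ℕ} (t : Finset (EuclideanSpace ℝ (Fin d))) (w : t → ℝ) :
    IsFiniteMeasure (mass t w) := by
  refine ⟨?_⟩
  unfold mass
  rw [Measure.finsetSum_apply]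
  refine ENNReal.sum_lt_top.2 fun p _ => ?_
  rw [Measure.smul_apply, smul_eq_mul]
  exact ENNReal.mul_lt_top ENNReal.ofReal_lt_top (measure_lt_top _ _)

theorem mass_ac {d : ℕ} (t : Finset (EuclideanSpace ℝ (Fin d))) (w : t → ℝ) :
    mass t w ≪ volume := by
  intro s hs
  unfold mass
  rw [Measure.finsetSum_apply]
  refine Finset.sum_eq_zero fun p _ => ?_
  rw [Measure.smul_apply, Measure.absolutelyContinuous_of_le Measure.restrict_le_self hs,
    smul_zero]

theorem mass_int {d k : ℕ} (t : Finset (EuclideanSpace ℝ (Fin d))) (w : t → ℝ)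
    (hw : ∀ p, 0 < w p) (a : Fin k → EuclideanSpace ℝ (Fin d)) (b : Fin k → ℝ)
    (J : Finset (Fin k)) : ∫ x, chi a b J x ∂(mass t w) = ∑ p, w p * mom a b J p := by
  unfold mass
  rw [integral_finsetSum_measure]
  · refine Finset.sum_congr rfl fun p _ => ?_
    rw [integral_smul_measure, ENNReal.toReal_ofReal (hw p).le, mom, smul_eq_mul]
  · intro p _
    exact (integrable_chi a b J _).smul_measure ENNReal.ofReal_ne_top

theorem count_J (k ℓ : ℕ) (h : ℓ ≤ k) :
    (2 ^ ℓ - 1) * (k - ℓ + 1) ≤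
      Fintype.card {J : Finset (Fin k) // J.Nonempty ∧ J.card ≤ ℓ} := by
  have h1 : ∀ n, (2 ^ ℓ - 1) * (n + 1) + 1 ≤ ∑ i ∈ Finset.range (ℓ + 1), (ℓ + n).choose i := by
    intro n
    induction n with
    | zero =>
      have := Nat.sum_range_choose ℓ
      have := Nat.one_le_two_pow (n := ℓ)
      simp only [Nat.add_zero]
      omega
    | succ n ih =>
      have e1 : ∑ i ∈ Finset.range (ℓ + 1), (ℓ + (n + 1)).choose i =
          ∑ i ∈ Finset.range (ℓ + 1), (ℓ + n).choose i
          + ∑ i ∈ Finset.range ℓ, (ℓ + n).choose i := by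
        rw [Finset.sum_range_succ' _ ℓ, Finset.sum_range_succ' _ ℓ, ← add_assoc ℓ n 1]
        simp only [Nat.choose_succ_succ, Finset.sum_add_distrib, Nat.choose_zero_right]
        simp only [Nat.succ_eq_add_one]
        ring
      have e2 : 2 ^ ℓ - 1 ≤ ∑ i ∈ Finset.range ℓ, (ℓ + n).choose i := by
        have := Nat.sum_range_choose ℓ
        rw [Finset.sum_range_succ, Nat.choose_self] at this
        have h3 : ∑ i ∈ Finset.range ℓ, ℓ.choose i ≤ ∑ i ∈ Finset.range ℓ, (ℓ + n).choose i :=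
          Finset.sum_le_sum fun i _ => Nat.choose_le_choose i (Nat.le_add_right _ _)
        omega
      rw [e1]
      have : (2 ^ ℓ - 1) * (n + 1 + 1) = (2 ^ ℓ - 1) * (n + 1) + (2 ^ ℓ - 1) := by ring
      omega
  have h2 := h1 (k - ℓ)
  rw [Nat.add_sub_cancel' h] at h2
  have h3 : ∑ i ∈ Finset.range (ℓ + 1), k.choose i =
      (Finset.univ.filter fun J : Finset (Fin k) => J.card ≤ ℓ).card := by
    rw [Finset.card_eq_sum_card_fiberwise (f := Finset.card) (t := Finset.range (ℓ + 1))]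
    · refine Finset.sum_congr rfl fun i hi => ?_
      rw [Finset.filter_filter]
      have : (Finset.univ.filter fun J : Finset (Fin k) => J.card ≤ ℓ ∧ J.card = i) =
          Finset.powersetCard i Finset.univ := by
        ext J
        simp only [Finset.mem_filter, Finset.mem_univ, true_and, Finset.mem_powersetCard,
          Finset.subset_univ]
        rw [Finset.mem_range] at hi
        omega
      rw [this, Finset.card_powersetCard, Finset.card_univ, Fintype.card_fin]
    · intro J hJ
      simp at hJ ⊢
      omega
  have h4 : (Finset.univ.filter fun J : Finset (Fin k) => J.card ≤ ℓ) =
      insert ∅ (Finset.univ.filter fun J : Finset (Fin k) => J.Nonempty ∧ J.card ≤ ℓ) := by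
    ext J
    simp only [Finset.mem_filter, Finset.mem_univ, true_and, Finset.mem_insert]
    rcases J.eq_empty_or_nonempty with rfl | hJ
    · simp
    · simp [hJ, hJ.ne_empty]
  rw [Fintype.card_subtype]
  rw [h3, h4, Finset.card_insert_of_notMem (by simp)] at h2
  omega

theorem count_pairs (k : ℕ) :
    Fintype.card {p : Fin k × Fin k // p.1 ≤ p.2} = k * (k + 1) / 2 := by
  have h1 : Fintype.card {p : Fin k × Fin k // p.1 ≤ p.2} = ∑ j : Fin k, (j.1 + 1) := by
    rw [Fintype.card_subtype, Finset.card_filter, ← Finset.univ_product_univ,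
      Finset.sum_product_right]
    refine Finset.sum_congr rfl fun j _ => ?_
    rw [← Finset.card_filter]
    have : (Finset.univ.filter fun i : Fin k => i ≤ j) = Finset.Iic j := by ext; simp
    simp [this]
  rw [h1, Fin.sum_univ_eq_sum_range (fun j => j + 1) k]
  have h2 := Finset.sum_range_succ' (fun j => j) k
  rw [add_zero] at h2
  rw [← h2, Finset.sum_range_id, Nat.add_sub_cancel, mul_comm]

/-- The linearised orthonormality constraint. -/
def orthL {d k : ℕ} (a₀ : Fin k → EuclideanSpace ℝ (Fin d)) :
    ((Fin k → EuclideanSpace ℝ (Fin d)) × (Fin k → ℝ)) →ₗ[ℝ]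
      ({p : Fin k × Fin k // p.1 ≤ p.2} → ℝ) where
  toFun c p := ⟪c.1 p.1.1, a₀ p.1.2⟫ + ⟪a₀ p.1.1, c.1 p.1.2⟫
  map_add' c c' := by
    ext p
    simp only [Prod.fst_add, Pi.add_apply, inner_add_left, inner_add_right]
    ring
  map_smul' r c := by
    ext p
    simp only [Prod.smul_fst, Pi.smul_apply, inner_smul_left, inner_smul_right, RingHom.id_apply,
      smul_eq_mul, conj_trivial]
    ring

theorem orthL_surj {d k : ℕ} (a₀ : Fin k → EuclideanSpace ℝ (Fin d))
    (ha : ∀ i j, ⟪a₀ i, a₀ j⟫ = if i = j then (1 : ℝ) else 0) :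
    Function.Surjective (orthL a₀) := by
  intro y
  let T : Fin k → Fin k → ℝ := fun i j =>
    if h : i ≤ j then (if i = j then y ⟨(i, j), h⟩ / 2 else y ⟨(i, j), h⟩) else 0
  refine ⟨(fun i => ∑ l, T i l • a₀ l, 0), ?_⟩
  ext ⟨⟨i, j⟩, hij⟩
  have hij' : i ≤ j := hij
  simp only [orthL, LinearMap.coe_mk, AddHom.coe_mk, sum_inner, inner_sum, inner_smul_left,
    inner_smul_right, ha, conj_trivial, mul_ite, mul_one, mul_zero, Finset.sum_ite_eq,
    Finset.sum_ite_eq', Finset.mem_univ, if_true]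
  rcases hij'.eq_or_lt with rfl | hlt
  · simp [T]
  · simp [T, hij', hlt.ne, not_le.2 hlt]

/-- The set of (orthonormal configuration, weights) satisfying all moment equations. -/
def badSet {d : ℕ} (m ℓ k : ℕ) (t : Finset (EuclideanSpace ℝ (Fin d))) :
    Set (((Fin k → EuclideanSpace ℝ (Fin d)) × (Fin k → ℝ)) × (Fin m → t → ℝ)) :=
  {z | (∀ i j, ⟪z.1.1 i, z.1.1 j⟫ = if i = j then (1 : ℝ) else 0) ∧ (∀ j, |z.1.2 j| ≤ 1) ∧
    ∀ r, ∀ J : {J : Finset (Fin k) // J.Nonempty ∧ J.card ≤ ℓ},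
      ∑ p, z.2 r p * mom z.1.1 z.1.2 J p = 0}

/-- The moment map at a fixed configuration. -/
def momL {d k : ℕ} (m ℓ : ℕ) (t : Finset (EuclideanSpace ℝ (Fin d)))
    (a : Fin k → EuclideanSpace ℝ (Fin d)) (b : Fin k → ℝ) :
    (Fin m → t → ℝ) →ₗ[ℝ] (Fin m → {J : Finset (Fin k) // J.Nonempty ∧ J.card ≤ ℓ} → ℝ) where
  toFun w r J := ∑ p, w r p * mom a b J p
  map_add' w w' := by
    ext r J
    simp only [Pi.add_apply, add_mul, Finset.sum_add_distrib]
  map_smul' c w := by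
    ext r J
    simp only [Pi.smul_apply, smul_eq_mul, RingHom.id_apply, Finset.mul_sum, mul_assoc]

theorem unit_of_orth {d k : ℕ} {a : Fin k → EuclideanSpace ℝ (Fin d)}
    (ha : ∀ i j, ⟪a i, a j⟫ = if i = j then (1 : ℝ) else 0) (i : Fin k) : ‖a i‖ = 1 := by
  have := ha i i
  rw [real_inner_self_eq_norm_sq, if_pos rfl] at this
  nlinarith [norm_nonneg (a i)]

theorem mom_lip_unif {d k : ℕ} (hd : 1 ≤ d) (t : Finset (EuclideanSpace ℝ (Fin d))) :
    ∃ K : ℝ, 0 ≤ K ∧ ∀ (c c' : (Fin k → EuclideanSpace ℝ (Fin d)) × (Fin k → ℝ)),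
      (∀ i, ‖c.1 i‖ = 1) → ∀ (J : Finset (Fin k)) (p : t),
      |mom c.1 c.2 J p - mom c'.1 c'.2 J p| ≤ K * ‖c - c'‖ := by
  choose K hK0 hK using fun q : Finset (Fin k) × t =>
    mom_lip hd q.1 (q.2 : EuclideanSpace ℝ (Fin d))
  refine ⟨∑ q, K q, Finset.sum_nonneg fun q _ => hK0 q, fun c c' hc J p => ?_⟩
  refine (hK (J, p) c.1 c'.1 c.2 c'.2 hc).trans ?_
  refine mul_le_mul_of_nonneg_right ?_ (norm_nonneg _)
  exact Finset.single_le_sum (fun q _ => hK0 q) (Finset.mem_univ (J, p))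

theorem orth_small {d k : ℕ} (a₀ : Fin k → EuclideanSpace ℝ (Fin d)) (b₀ : Fin k → ℝ) (r : ℝ)
    (hr : 0 ≤ r)
    (c c' : (Fin k → EuclideanSpace ℝ (Fin d)) × (Fin k → ℝ))
    (hc : ∀ i j, ⟪c.1 i, c.1 j⟫ = if i = j then (1 : ℝ) else 0)
    (hc' : ∀ i j, ⟪c'.1 i, c'.1 j⟫ = if i = j then (1 : ℝ) else 0)
    (h : ‖c - (a₀, b₀)‖ ≤ r) (h' : ‖c' - (a₀, b₀)‖ ≤ r) :
    ‖orthL a₀ (c - c')‖ ≤ 2 * r * ‖c - c'‖ := by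
  have hn : ∀ (e : (Fin k → EuclideanSpace ℝ (Fin d)) × (Fin k → ℝ)) i, ‖e.1 i‖ ≤ ‖e‖ :=
    fun e i => (norm_le_pi_norm e.1 i).trans (norm_fst_le e)
  rw [pi_norm_le_iff_of_nonneg (by positivity)]
  rintro ⟨⟨i, j⟩, hij⟩
  have e : orthL a₀ (c - c') ⟨(i, j), hij⟩ =
      -⟪(c - c').1 i, (c - (a₀, b₀)).1 j⟫ - ⟪(c' - (a₀, b₀)).1 i, (c - c').1 j⟫ := by
    have h1 := hc i j
    have h2 := hc' i j
    simp only [orthL, LinearMap.coe_mk, AddHom.coe_mk, Prod.fst_sub, Pi.sub_apply,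
      inner_sub_left, inner_sub_right]
    linarith
  rw [e, Real.norm_eq_abs]
  refine (abs_sub _ _).trans ?_
  rw [abs_neg]
  have h1 := abs_real_inner_le_norm ((c - c').1 i) ((c - (a₀, b₀)).1 j)
  have h2 := abs_real_inner_le_norm ((c' - (a₀, b₀)).1 i) ((c - c').1 j)
  have h3 := mul_le_mul (hn (c - c') i) ((hn (c - (a₀, b₀)) j).trans h) (norm_nonneg _)
    (norm_nonneg _)
  have h4 := mul_le_mul ((hn (c' - (a₀, b₀)) i).trans h') (hn (c - c') j) (norm_nonneg _) hr
  linarith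

theorem bad_dense {d : ℕ} (m ℓ k : ℕ) (hd : 1 ≤ d) (hℓk : ℓ ≤ k)
    (h : k * d - k * (k - 1) / 2 < m * (2 ^ ℓ - 1) * (k - ℓ + 1))
    (t : Finset (EuclideanSpace ℝ (Fin d)))
    (ht : ∀ x ∈ Metric.closedBall (0 : EuclideanSpace ℝ (Fin d)) (2 * k), ∃ p ∈ t,
      dist x p < 1 / 2) :
    Dense (Prod.snd '' badSet m ℓ k t)ᶜ := by
  apply aux_core (Y₁ := {p : Fin k × Fin k // p.1 ≤ p.2} → ℝ)
    (Y₂ := Fin m → {J : Finset (Fin k) // J.Nonempty ∧ J.card ≤ ℓ} → ℝ)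
  · rintro ⟨z, hz, -⟩
    have hkd : k ≤ d := by
      have ho : Orthonormal ℝ z.1.1 :=
        ⟨fun i => unit_of_orth hz i, fun i j hij => by
          change ⟪z.1.1 i, z.1.1 j⟫ = (0 : ℝ)
          rw [hz, if_neg hij]⟩
      simpa using ho.linearIndependent.fintype_card_le_finrank
    have hc := Nat.mul_le_mul_left m (count_J k ℓ hℓk)
    rw [← mul_assoc] at hc
    have h1 : Module.finrank ℝ ((Fin k → EuclideanSpace ℝ (Fin d)) × (Fin k → ℝ)) =
        k * d + k := by
      rw [Module.finrank_prod, Module.finrank_pi_fintype]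
      simp
    have h2 : Module.finrank ℝ ({p : Fin k × Fin k // p.1 ≤ p.2} → ℝ) = k * (k + 1) / 2 := by
      rw [Module.finrank_fintype_fun_eq_card, count_pairs]
    have h3 : Module.finrank ℝ
        (Fin m → {J : Finset (Fin k) // J.Nonempty ∧ J.card ≤ ℓ} → ℝ) =
        m * Fintype.card {J : Finset (Fin k) // J.Nonempty ∧ J.card ≤ ℓ} := by
      rw [Module.finrank_pi_fintype]
      simp only [Module.finrank_fintype_fun_eq_card]
      simp
    rw [h1, h2, h3]
    have h4 : k * (k + 1) / 2 = k * (k - 1) / 2 + k := by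
      rcases k with _ | n
      · simp
      · have : (n + 1) * (n + 1 + 1) = (n + 1) * (n + 1 - 1) + 2 * (n + 1) := by
          rw [Nat.add_sub_cancel]; ring
        omega
    omega
  · rintro ⟨⟨a₀, b₀⟩, w₀⟩ hz₀
    obtain ⟨K, hK0, hK⟩ := mom_lip_unif (k := k) hd t
    refine ⟨orthL a₀, momL m ℓ t a₀ b₀, orthL_surj a₀ hz₀.1, ?_, ?_, ?_⟩
    · intro y
      choose w hw using fun r => mom_surj t ht a₀ b₀ hz₀.1 hz₀.2.1
        (fun J => if hJ : J.Nonempty ∧ J.card ≤ ℓ then y r ⟨J, hJ⟩ else 0)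
      refine ⟨w, ?_⟩
      ext r J
      have := hw r J
      rw [dif_pos J.2] at this
      exact this
    · intro ε hε
      refine ⟨ε / 2, by positivity, ?_⟩
      rintro ⟨c, w⟩ hz ⟨c', w'⟩ hz' hd1 hd2
      rw [dist_eq_norm] at hd1 hd2
      have := orth_small a₀ b₀ (ε / 2) (by positivity) c c' hz.1 hz'.1
        ((norm_fst_le _).trans hd1.le) ((norm_fst_le _).trans hd2.le)
      rw [mul_div_cancel₀ _ (two_ne_zero)] at this
      exact this
    · refine ⟨Fintype.card t * (K * (‖w₀‖ + 1)), by positivity, fun ε hε => ?_⟩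
      refine ⟨min 1 (ε / (Fintype.card t * K + 1)), by positivity, ?_⟩
      rintro ⟨c, w⟩ hz ⟨c', w'⟩ hz' hd1 hd2
      rw [dist_eq_norm, lt_min_iff] at hd1 hd2
      have hN : 0 < (Fintype.card t : ℝ) * K + 1 := by positivity
      have hc0 : (Fintype.card t : ℝ) * K * ‖((a₀, b₀) : (_ × _)) - c‖ ≤ ε := by
        have e1 : ‖((a₀, b₀) : (_ × _)) - c‖ ≤ ε / (Fintype.card t * K + 1) := by
          rw [norm_sub_rev]; exact (norm_fst_le _).trans hd1.2.le
        rw [le_div_iff₀ hN] at e1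
        nlinarith [norm_nonneg (((a₀, b₀) : (_ × _)) - c)]
      have hw' : ‖w'‖ ≤ ‖w₀‖ + 1 := by
        have e1 : ‖w' - w₀‖ ≤ 1 := (norm_snd_le (((c', w') : (_ × _)) - ((a₀, b₀), w₀))).trans
          hd2.1.le
        have := norm_le_norm_add_norm_sub' w' w₀
        linarith
      have hent : ∀ (v : Fin m → t → ℝ) r p, |v r p| ≤ ‖v‖ := fun v r p =>
        (norm_le_pi_norm (v r) p).trans (norm_le_pi_norm v r)
      change ‖momL m ℓ t a₀ b₀ (w - w')‖ ≤ _ * ‖c - c'‖ + ε * ‖w - w'‖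
      rw [pi_norm_le_iff_of_nonneg (by positivity)]
      intro r
      rw [pi_norm_le_iff_of_nonneg (by positivity)]
      intro J
      have z1 : ∑ p, w r p * mom c.1 c.2 J p = 0 := hz.2.2 r J
      have z2 : ∑ p, w' r p * mom c'.1 c'.2 J p = 0 := hz'.2.2 r J
      have e : momL m ℓ t a₀ b₀ (w - w') r J =
          ∑ p : t, ((w - w') r p * (mom a₀ b₀ J p - mom c.1 c.2 J p)
            - w' r p * (mom c.1 c.2 J p - mom c'.1 c'.2 J p)) := by
        have : momL m ℓ t a₀ b₀ (w - w') r J = ∑ p : t, (w - w') r p * mom a₀ b₀ J p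
            - ∑ p, w r p * mom c.1 c.2 J p + ∑ p, w' r p * mom c'.1 c'.2 J p := by
          rw [z1, z2, sub_zero, add_zero]; rfl
        rw [this, ← Finset.sum_sub_distrib, ← Finset.sum_add_distrib]
        refine Finset.sum_congr rfl fun p _ => ?_
        simp only [Pi.sub_apply]
        ring
      rw [e]
      calc _ ≤ ∑ p : t, (‖w - w'‖ * (K * ‖((a₀, b₀) : (_ × _)) - c‖)
            + (‖w₀‖ + 1) * (K * ‖c - c'‖)) := by
            refine norm_sum_le_of_le _ fun p _ => ?_
            refine (norm_sub_le _ _).trans ?_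
            rw [norm_mul, norm_mul]
            refine add_le_add ?_ ?_
            · exact mul_le_mul (hent _ _ _) (hK (a₀, b₀) c (unit_of_orth hz₀.1) J p)
                (norm_nonneg _) (norm_nonneg _)
            · exact mul_le_mul ((hent _ _ _).trans hw') (hK c c' (unit_of_orth hz.1) J p)
                (norm_nonneg _) (by positivity)
        _ = (Fintype.card t * K * ‖((a₀, b₀) : (_ × _)) - c‖) * ‖w - w'‖
            + Fintype.card t * (K * (‖w₀‖ + 1)) * ‖c - c'‖ := by
            rw [Finset.sum_const, Finset.card_univ, nsmul_eq_mul]; ring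
        _ ≤ ε * ‖w - w'‖ + Fintype.card t * (K * (‖w₀‖ + 1)) * ‖c - c'‖ := by gcongr
        _ = _ := by ring

theorem exists_net (d k : ℕ) : ∃ t : Finset (EuclideanSpace ℝ (Fin d)), 0 ∈ t ∧
    ∀ x ∈ Metric.closedBall (0 : EuclideanSpace ℝ (Fin d)) (2 * k), ∃ p ∈ t,
      dist x p < 1 / 2 := by
  classical
  obtain ⟨T, hTf, hT⟩ := Metric.totallyBounded_iff.1
    (isCompact_closedBall (0 : EuclideanSpace ℝ (Fin d)) (2 * k)).totallyBounded (1 / 2)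
    (by norm_num)
  refine ⟨insert 0 hTf.toFinset, by simp, fun x hx => ?_⟩
  obtain ⟨p, hp, hxp⟩ := Set.mem_iUnion₂.1 (hT hx)
  exact ⟨p, by simp [hp], hxp⟩

theorem b_bound {d k : ℕ} (t : Finset (EuclideanSpace ℝ (Fin d))) (h0 : 0 ∈ t) (w : t → ℝ)
    (hw : ∀ p, 0 < w p) (hw0 : ∑ p, w p < 2 * w ⟨0, h0⟩)
    (a : Fin k → EuclideanSpace ℝ (Fin d)) (b : Fin k → ℝ) (j : Fin k) (ha : ‖a j‖ = 1)
    (h : ∑ p, w p * mom a b {j} p = 0) : |b j| ≤ 1 := by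
  by_contra hcon
  push Not at hcon
  set V := volume.real (Metric.ball (0 : EuclideanSpace ℝ (Fin d)) (1 / 2)) with hV
  have hVp : 0 < V := ball_vol_pos _
  have hVeq : ∀ p : EuclideanSpace ℝ (Fin d), volume.real (Metric.ball p (1 / 2)) = V := by
    intro p
    rw [hV, Measure.real, Measure.real, Measure.addHaar_ball_center]
  have hin : ∀ x ∈ Metric.ball (0 : EuclideanSpace ℝ (Fin d)) (1 / 2), |⟪a j, x⟫| < 1 := by
    intro x hx
    refine (abs_real_inner_le_norm _ _).trans_lt ?_
    rw [mem_ball_zero_iff] at hx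
    rw [ha, one_mul]; linarith
  have hm0 : |mom a b {j} 0| = V := by
    have hc := mom_const a b {j} 0 (fun _ => decide (b j < 0)) (by
      intro x hx i hi
      rw [Finset.mem_singleton] at hi
      subst hi
      have h1 := abs_lt.1 (hin x hx)
      unfold pat
      rcases lt_abs.1 hcon with h2 | h2
      · simp only [decide_eq_decide]
        constructor <;> intro h3 <;> linarith [h1.1, h1.2]
      · simp only [decide_eq_decide]
        constructor <;> intro h3 <;> linarith [h1.1, h1.2])
    rw [hc, Finset.prod_singleton, abs_mul, abs_sg, mul_one, hVeq, abs_of_pos hVp]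
  let q : t := ⟨0, h0⟩
  rw [← Finset.add_sum_erase _ _ (Finset.mem_univ q)] at h hw0
  have h1 : |∑ p ∈ Finset.univ.erase q, w p * mom a b {j} p| ≤
      (∑ p ∈ Finset.univ.erase q, w p) * V := by
    rw [Finset.sum_mul]
    refine (Finset.abs_sum_le_sum_abs _ _).trans (Finset.sum_le_sum fun p _ => ?_)
    rw [abs_mul, abs_of_pos (hw p)]
    refine mul_le_mul_of_nonneg_left ?_ (hw p).le
    exact (abs_mom_le a b {j} p).trans (hVeq p).le
  have h2 : |w q * mom a b {j} q| = w q * V := by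
    rw [abs_mul, abs_of_pos (hw q)]
    exact congrArg (w q * ·) hm0
  have h3 : |∑ p ∈ Finset.univ.erase q, w p * mom a b {j} p| = w q * V := by
    rw [← h2, ← abs_neg]
    congr 1
    linarith
  have h4 : ∑ p ∈ Finset.univ.erase q, w p < w q := by
    change w q + _ < 2 * w q at hw0
    linarith
  have := mul_lt_mul_of_pos_right h4 hVp
  linarith

theorem region_normalize {d k : ℕ} (a : Fin k → EuclideanSpace ℝ (Fin d)) (b : Fin k → ℝ)
    (ha : ∀ i, a i ≠ 0) (s : Finset (Fin k)) (ε : Fin k → Bool) :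
    region (fun i => ‖a i‖⁻¹ • a i) (fun i => ‖a i‖⁻¹ * b i) s ε = region a b s ε := by
  unfold region
  refine Set.iInter₂_congr fun i _ => ?_
  have hn : 0 < ‖a i‖⁻¹ := inv_pos.2 (norm_pos_iff.2 (ha i))
  unfold halfSpace
  simp only [inner_smul_left, conj_trivial, mul_le_mul_iff_right₀ hn]

theorem stmt_5 (m ℓ k d : ℕ) (hm : 1 ≤ m) (hℓ : 2 ≤ ℓ) (hℓk : ℓ ≤ k) (hd : 1 ≤ d)
    (h : k * d - k * (k - 1) / 2 < m * (2 ^ ℓ - 1) * (k - ℓ + 1)) :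
    ∃ μ : Fin m → Measure (EuclideanSpace ℝ (Fin d)),
      (∀ r, IsFiniteMeasure (μ r)) ∧ (∀ r, μ r ≪ volume) ∧
      ¬ ∃ (a : Fin k → EuclideanSpace ℝ (Fin d)) (b : Fin k → ℝ),
          (∀ i, a i ≠ 0) ∧
          (∀ i j, i ≠ j → ⟪a i, a j⟫ = (0 : ℝ)) ∧
          ∀ r : Fin m, ∀ s : Finset (Fin k), s.card = ℓ → ∀ ε : Fin k → Bool,
            μ r (region a b s ε) = μ r Set.univ / 2 ^ ℓ := by
  classical
  obtain ⟨t, h0, ht⟩ := exists_net d k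
  let q : t := ⟨0, h0⟩
  let U : Set (Fin m → t → ℝ) :=
    {w | ∀ r, (∀ p, 0 < w r p) ∧ ∑ p, w r p < 2 * w r q}
  have hUo : IsOpen U := by
    have : U = ⋂ r, ((⋂ p, {w : Fin m → t → ℝ | 0 < w r p}) ∩
        {w | ∑ p, w r p < 2 * w r q}) := by
      ext w; simp [U]
    rw [this]
    refine isOpen_iInter_of_finite fun r => IsOpen.inter
      (isOpen_iInter_of_finite fun p => ?_) ?_
    · exact isOpen_lt continuous_const (by fun_prop)
    · exact isOpen_lt (by fun_prop) (by fun_prop)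
  have hUn : U.Nonempty := by
    refine ⟨fun _ p => if p = q then (Fintype.card t : ℝ) + 1 else 1, fun r => ⟨fun p => ?_, ?_⟩⟩
    · beta_reduce
      split_ifs <;> positivity
    · rw [← Finset.add_sum_erase _ _ (Finset.mem_univ q),
        Finset.sum_congr rfl (g := fun _ => (1 : ℝ))
          (fun p hp => if_neg (Finset.ne_of_mem_erase hp))]
      simp only [if_true, Finset.sum_const, nsmul_eq_mul, mul_one]
      have : ((Finset.univ.erase q).card : ℝ) ≤ Fintype.card t := by
        exact_mod_cast Finset.card_le_univ _
      linarith
  obtain ⟨w, hwU, hwb⟩ := (bad_dense m ℓ k hd hℓk h t ht).inter_open_nonempty U hUo hUn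
  refine ⟨fun r => mass t (w r), fun r => mass_fin t _, fun r => mass_ac t _, ?_⟩
  rintro ⟨a, b, ha0, horth, heq⟩
  apply hwb
  let a' : Fin k → EuclideanSpace ℝ (Fin d) := fun i => ‖a i‖⁻¹ • a i
  let b' : Fin k → ℝ := fun i => ‖a i‖⁻¹ * b i
  have ha' : ∀ i j, ⟪a' i, a' j⟫ = if i = j then (1 : ℝ) else 0 := by
    intro i j
    simp only [a', inner_smul_left, inner_smul_right, conj_trivial]
    split_ifs with hij
    · subst hij
      have := norm_ne_zero_iff.2 (ha0 i)
      rw [real_inner_self_eq_norm_sq]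
      field_simp
    · rw [horth i j hij]; simp
  have hne : ∀ i, a' i ≠ 0 := fun i hi => by
    have := unit_of_orth ha' i
    rw [hi] at this
    simp at this
  have hmom : ∀ r, ∀ J : Finset (Fin k), J.Nonempty → J.card ≤ ℓ →
      ∑ p, w r p * mom a' b' J p = 0 := by
    intro r J hJ hJc
    obtain ⟨s, hJs, hs⟩ := Finset.exists_superset_card_eq hJc (by simpa using hℓk)
    haveI := mass_fin t (w r)
    rw [← mass_int t (w r) (hwU r).1]
    refine equi_chi (ℓ := ℓ) (mass t (w r)) (mass_ac t _) a' b' hne s J hJs hJ fun ε => ?_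
    rw [region_normalize a b ha0]
    exact heq r s hs ε
  refine ⟨((a', b'), w), ⟨ha', fun j => ?_, fun r J => hmom r J J.2.1 J.2.2⟩, rfl⟩
  let r0 : Fin m := ⟨0, hm⟩
  exact b_bound t h0 (w r0) (hwU r0).1 (hwU r0).2 a' b' j (unit_of_orth ha' j)
    (hmom r0 {j} (Finset.singleton_nonempty j) (by simp; omega))
end
end

section
/- Let k ≥ 2, q ≥ 0 and 1 ≤ t ≤ 2^q be integers and let d = 2^q·(k+1) − t. For any 2^{q+1} − 1 masses μ_1, …, μ_{2^{q+1}−1} on ℝ^d there exist k hyperplanes H_1, …, H_k in ℝ^d such that (i) any two of H_1, …, H_k equipartition each of the first 2^{q+1} − t masses μ_1, …, μ_{2^{q+1}−t}, and (ii) any two of H_2, …, H_k equipartition each of the remaining t − 1 masses μ_{2^{q+1}−t+1}, …, μ_{2^{q+1}−1}. -/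
open MeasureTheory RealInnerProductSpace

noncomputable section

namespace PairEquip

/-- Mod 2 chains spanned by finite ordered tuples of points (augmented: the empty tuple counts). -/
abbrev Ch (X : Type*) := List X →₀ ZMod 2

section chains
variable {X : Type*}

lemma ch_add_self (z : Ch X) : z + z = 0 := by
  ext L; simp [CharTwo.add_self_eq_zero]

/-- Linear extension of a function on tuples. -/
abbrev ext {V : Type*} [AddCommGroup V] [Module (ZMod 2) V] (g : List X → V) :
    Ch X →ₗ[ZMod 2] V := Finsupp.linearCombination (ZMod 2) g

@[simp] lemma ext_single {V : Type*} [AddCommGroup V] [Module (ZMod 2) V] (g : List X → V)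
    (L : List X) : ext g (Finsupp.single L 1) = g L := by
  simp [ext]

lemma lin_ext {V : Type*} [AddCommGroup V] [Module (ZMod 2) V] {f g : Ch X →ₗ[ZMod 2] V}
    (h : ∀ L, f (Finsupp.single L 1) = g (Finsupp.single L 1)) : f = g := by
  refine Finsupp.lhom_ext' fun L => LinearMap.ext_ring ?_
  simpa using h L

/-- Equality of two linear maps on a chain supported in a set of tuples. -/
lemma lin_eq_on {V : Type*} [AddCommGroup V] [Module (ZMod 2) V] {f g : Ch X →ₗ[ZMod 2] V}
    {S : Set (List X)} (h : ∀ L ∈ S, f (Finsupp.single L 1) = g (Finsupp.single L 1))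
    {z : Ch X} (hz : z ∈ Finsupp.supported (ZMod 2) (ZMod 2) S) : f z = g z := by
  rw [Finsupp.supported_eq_span_single] at hz
  induction hz using Submodule.span_induction with
  | mem x hx => obtain ⟨L, hL, rfl⟩ := hx; exact h L hL
  | zero => simp
  | add x y _ _ hx hy => simp [hx, hy]
  | smul a x _ hx => simp [hx]

lemma lin_mem {V : Type*} [AddCommGroup V] [Module (ZMod 2) V] {f : Ch X →ₗ[ZMod 2] V}
    {S : Set (List X)} {W : Submodule (ZMod 2) V}
    (h : ∀ L ∈ S, f (Finsupp.single L 1) ∈ W)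
    {z : Ch X} (hz : z ∈ Finsupp.supported (ZMod 2) (ZMod 2) S) : f z ∈ W := by
  rw [Finsupp.supported_eq_span_single] at hz
  induction hz using Submodule.span_induction with
  | mem x hx => obtain ⟨L, hL, rfl⟩ := hx; exact h L hL
  | zero => simp
  | add x y _ _ hx hy => simpa using W.add_mem hx hy
  | smul a x _ hx => simpa using W.smul_mem a hx

def consC (v : X) : Ch X →ₗ[ZMod 2] Ch X := ext fun L => Finsupp.single (v :: L) 1

def mapC (f : X → X) : Ch X →ₗ[ZMod 2] Ch X := ext fun L => Finsupp.single (L.map f) 1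

def bdL : List X → Ch X
  | [] => 0
  | v :: L => Finsupp.single L 1 + consC v (bdL L)

def bd : Ch X →ₗ[ZMod 2] Ch X := ext bdL

@[simp] lemma consC_single (v : X) (L : List X) :
    consC v (Finsupp.single L 1) = Finsupp.single (v :: L) 1 := by simp [consC]
@[simp] lemma mapC_single (f : X → X) (L : List X) :
    mapC f (Finsupp.single L 1) = Finsupp.single (L.map f) 1 := by simp [mapC]
@[simp] lemma bd_single (L : List X) : bd (Finsupp.single L 1) = bdL L := by simp [bd]

lemma bd_consC (v : X) (z : Ch X) : bd (consC v z) = z + consC v (bd z) := by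
  have : bd ∘ₗ consC v = LinearMap.id + consC v ∘ₗ bd := lin_ext fun L => by simp [bdL]
  exact LinearMap.congr_fun this z

lemma mapC_consC (f : X → X) (v : X) (z : Ch X) :
    mapC f (consC v z) = consC (f v) (mapC f z) := by
  have : mapC f ∘ₗ consC v = consC (f v) ∘ₗ mapC f := lin_ext fun L => by simp
  exact LinearMap.congr_fun this z

lemma bd_mapC (f : X → X) (z : Ch X) : bd (mapC f z) = mapC f (bd z) := by
  have : bd ∘ₗ mapC f = mapC f ∘ₗ bd := lin_ext fun L => by
    induction L with
    | nil => simp [bdL]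
    | cons v L ih =>
      simp only [LinearMap.comp_apply, mapC_single, bd_single, List.map_cons, bdL, map_add,
        mapC_consC] at ih ⊢
      rw [ih]
  exact LinearMap.congr_fun this z

lemma mapC_mapC (f g : X → X) (z : Ch X) : mapC f (mapC g z) = mapC (f ∘ g) z := by
  have : mapC f ∘ₗ mapC g = mapC (f ∘ g) := lin_ext fun L => by simp
  exact LinearMap.congr_fun this z

lemma mapC_id (z : Ch X) : mapC id z = z := by
  have : mapC id = (LinearMap.id : Ch X →ₗ[ZMod 2] Ch X) := lin_ext fun L => by simp
  exact LinearMap.congr_fun this z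

/-- prism operator -/
def prL (f g : X → X) : List X → Ch X
  | [] => 0
  | v :: L => Finsupp.single (f v :: g v :: L.map g) 1 + consC (f v) (prL f g L)

def pr (f g : X → X) : Ch X →ₗ[ZMod 2] Ch X := ext (prL f g)

@[simp] lemma pr_single (f g : X → X) (L : List X) :
    pr f g (Finsupp.single L 1) = prL f g L := by simp [pr]

lemma pr_consC (f g : X → X) (v : X) (z : Ch X) :
    pr f g (consC v z) = consC (f v) (consC (g v) (mapC g z)) + consC (f v) (pr f g z) := by
  have : pr f g ∘ₗ consC v = consC (f v) ∘ₗ consC (g v) ∘ₗ mapC g + consC (f v) ∘ₗ pr f g :=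
    lin_ext fun L => by simp [prL]
  exact LinearMap.congr_fun this z

lemma bd_pr (f g : X → X) (z : Ch X) :
    bd (pr f g z) = mapC f z + mapC g z + pr f g (bd z) := by
  have : bd ∘ₗ pr f g = mapC f + mapC g + pr f g ∘ₗ bd := lin_ext fun L => by
    induction L with
    | nil => simp [bdL, prL, ch_add_self]
    | cons v L ih =>
      simp only [LinearMap.comp_apply, LinearMap.add_apply, mapC_single, bd_single, pr_single,
        List.map_cons, bdL, map_add, prL, pr_consC, bd_consC] at ih ⊢
      rw [ih]
      have h := bd_mapC g (Finsupp.single L 1)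
      simp only [mapC_single, bd_single] at h
      rw [h]
      simp only [map_add, consC_single]
      ext M
      simp only [Finsupp.add_apply]
      generalize (consC (f v) (consC (g v) (mapC g (bdL L)))) M = a1
      generalize (prL f g L) M = a2
      generalize (consC (f v) ((pr f g) (bdL L))) M = a3
      generalize (Finsupp.single (f v :: List.map g L) 1 : Ch X) M = a4
      generalize (Finsupp.single (f v :: List.map f L) 1 : Ch X) M = a5
      generalize (Finsupp.single (g v :: List.map g L) 1 : Ch X) M = a6
      have : a4 + a4 = 0 := CharTwo.add_self_eq_zero a4
      linear_combination this
  exact LinearMap.congr_fun this z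

lemma prL_mem (f g : X → X) (L : List X) : prL f g L ∈ Finsupp.supported (ZMod 2) (ZMod 2)
    {L' : List X | L'.length = L.length + 1 ∧ ∀ u ∈ L', ∃ v ∈ L, u = f v ∨ u = g v} := by
  induction L with
  | nil => simp [prL]
  | cons v L ih =>
    rw [prL]
    refine Submodule.add_mem _ ?_ (lin_mem ?_ ih)
    · refine Finsupp.single_mem_supported _ _ ?_
      refine ⟨by simp, ?_⟩
      intro u hu
      simp only [List.mem_cons, List.mem_map] at hu
      rcases hu with rfl | rfl | ⟨w, hw, rfl⟩
      · exact ⟨v, by simp, Or.inl rfl⟩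
      · exact ⟨v, by simp, Or.inr rfl⟩
      · exact ⟨w, by simp [hw], Or.inr rfl⟩
    · rintro L' ⟨h1, h2⟩
      rw [consC_single]
      refine Finsupp.single_mem_supported _ _ ⟨by simp [h1], ?_⟩
      intro u hu
      rcases List.mem_cons.1 hu with rfl | hu
      · exact ⟨v, by simp, Or.inl rfl⟩
      · obtain ⟨w, hw, h⟩ := h2 u hu
        exact ⟨w, by simp [hw], h⟩

/-- filling operator -/
def fill (φ : ℕ → X → X) (M : ℕ) (c : X) (z : Ch X) : Ch X :=
  ∑ m ∈ Finset.range M, pr (φ m) (φ (m + 1)) z + consC c (mapC (φ M) z)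

lemma bd_fill (φ : ℕ → X → X) (M : ℕ) (c : X) (z : Ch X) (h0 : φ 0 = id) (hz : bd z = 0) :
    bd (fill φ M c z) = z := by
  rw [fill, map_add, bd_consC, bd_mapC, hz, map_zero, map_zero, add_zero]
  induction M with
  | zero => simp [h0, mapC_id]
  | succ M ih =>
    rw [Finset.sum_range_succ, map_add, bd_pr, hz, map_zero, add_zero]
    rw [show ∀ a b c : Ch X, a + (b + c) + c = (a + b) + (c + c) from fun a b c => by abel,
      ch_add_self, add_zero, ih]

/-- cup product of coboundaries of the 0-cochains in `S` -/
def E : List (X → ZMod 2) → List X → ZMod 2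
  | [], _ => 1
  | _ :: _, [] => 0
  | _ :: _, [_] => 0
  | s :: S, v :: w :: L => (s v + s w) * E S (w :: L)

def A (s : X → ZMod 2) (S : List (X → ZMod 2)) : List X → ZMod 2
  | [] => 0
  | v :: L => s v * E S (v :: L)

lemma E_cons_cons (s : X → ZMod 2) (S : List (X → ZMod 2)) (v w : X) (z : Ch X) :
    ext (E (s :: S)) (consC v (consC w z)) = (s v + s w) * ext (E S) (consC w z) := by
  have : ext (E (s :: S)) ∘ₗ consC v ∘ₗ consC w = (s v + s w) • (ext (E S) ∘ₗ consC w) :=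
    lin_ext fun L => by simp [E]
  simpa using LinearMap.congr_fun this z

lemma A_cons (s : X → ZMod 2) (S : List (X → ZMod 2)) (v : X) (z : Ch X) :
    ext (A s S) (consC v z) = s v * ext (E S) (consC v z) := by
  have : ext (A s S) ∘ₗ consC v = (s v) • (ext (E S) ∘ₗ consC v) :=
    lin_ext fun L => by simp [A]
  simpa using LinearMap.congr_fun this z

lemma E_cocycle (S : List (X → ZMod 2)) : ∀ L : List X, L.length = S.length + 2 →
    ext (E S) (bdL L) = 0 := by
  induction S with
  | nil =>
    rintro (_ | ⟨v, _ | ⟨w, _ | ⟨u, L⟩⟩⟩) h <;> simp at h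
    simp [bdL, E]
    decide
  | cons s S ih =>
    rintro (_ | ⟨v, _ | ⟨w, _ | ⟨u, L⟩⟩⟩) h <;> simp at h
    have h1 := ih (w :: u :: L) (by simp; omega)
    rw [bdL] at h1
    rw [bdL, bdL]
    simp only [map_add, E_cons_cons, ext_single, consC_single] at h1 ⊢
    simp only [E]
    have h2 : ∀ a : ZMod 2, a + a = 0 := CharTwo.add_self_eq_zero
    linear_combination (s v + s w) * h1 + h2 (s u * E S (u :: L))

lemma A_bd (s : X → ZMod 2) (S : List (X → ZMod 2)) (L : List X)
    (hL : L.length = S.length + 2) : ext (A s S) (bdL L) = E (s :: S) L := by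
  rcases L with (_ | ⟨v, _ | ⟨w, L⟩⟩)
  · simp at hL
  · simp at hL
  have h1 := E_cocycle S (v :: w :: L) hL
  rw [bdL] at h1 ⊢
  simp only [map_add, A_cons, ext_single] at h1 ⊢
  simp only [E, A]
  have h2 : ∀ a : ZMod 2, a + a = 0 := CharTwo.add_self_eq_zero
  linear_combination (s v) * h1 - h2 (s v * E S (w :: L))

lemma E_map (T : X → X) (G : Set X) (S : List (X → ZMod 2))
    (hS : ∀ s ∈ S, ∃ a, ∀ x ∈ G, s (T x) = s x + a) :
    ∀ L : List X, (∀ v ∈ L, v ∈ G) → E S (L.map T) = E S L := by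
  induction S with
  | nil => simp [E]
  | cons s S ih =>
    rintro (_ | ⟨v, _ | ⟨w, L⟩⟩) hL
    · simp [E]
    · simp [E]
    obtain ⟨a, ha⟩ := hS s (by simp)
    have := ih (fun s hs => hS s (by simp [hs])) (w :: L)
      (fun u hu => hL u (List.mem_cons_of_mem _ hu))
    simp only [List.map_cons, E] at this ⊢
    rw [this, ha v (hL v (by simp)), ha w (hL w (by simp))]
    have h2 : ∀ a : ZMod 2, a + a = 0 := CharTwo.add_self_eq_zero
    linear_combination (E S (w :: L)) * h2 a

/-- `E` nonzero forces all cochains to change along the tuple -/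
lemma E_ne_zero (S : List (X → ZMod 2)) : ∀ L : List X, E S L ≠ 0 →
    ∀ s ∈ S, ∃ u ∈ L, ∃ w ∈ L, s u ≠ s w := by
  induction S with
  | nil => simp
  | cons s S ih =>
    rintro (_ | ⟨v, _ | ⟨w, L⟩⟩) h
    · simp [E] at h
    · simp [E] at h
    simp only [E] at h
    intro s' hs'
    rcases List.mem_cons.1 hs' with rfl | hs'
    · refine ⟨v, by simp, w, by simp, fun h' => left_ne_zero_of_mul h ?_⟩
      rw [h', CharTwo.add_self_eq_zero]
    · obtain ⟨u, hu, w', hw', h'⟩ := ih (w :: L) (right_ne_zero_of_mul h) s' hs'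
      exact ⟨u, List.mem_cons_of_mem _ hu, w', List.mem_cons_of_mem _ hw', h'⟩

end chains

section build
variable {k D : ℕ}

abbrev Pt (k D : ℕ) := Fin k → Fin (D + 1) → ℝ

def T (i : Fin k) (x : Pt k D) : Pt k D := Function.update x i (-(x i))

lemma T_T (i : Fin k) : (T i ∘ T i : Pt k D → Pt k D) = id := by
  funext x; simp [T]

lemma T_comm (i j : Fin k) : (T i ∘ T j : Pt k D → Pt k D) = T j ∘ T i := by
  funext x
  by_cases h : i = j
  · rw [h]
  · simp only [T, Function.comp]
    rw [Function.update_of_ne h, Function.update_of_ne (Ne.symm h), Function.update_comm h]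

def tw (i : Fin k) : Ch (Pt k D) →ₗ[ZMod 2] Ch (Pt k D) := LinearMap.id + mapC (T i)

lemma tw_apply (i : Fin k) (z : Ch (Pt k D)) : tw i z = z + mapC (T i) z := rfl

lemma bd_tw (i : Fin k) (z : Ch (Pt k D)) : bd (tw i z) = tw i (bd z) := by
  simp [tw_apply, bd_mapC]

lemma tw_tw (i : Fin k) (z : Ch (Pt k D)) : tw i (tw i z) = 0 := by
  simp only [tw_apply, map_add, mapC_mapC, T_T, mapC_id]
  rw [show z + mapC (T i) z + (mapC (T i) z + z) = (z + mapC (T i) z) + (z + mapC (T i) z) by abel]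
  exact ch_add_self _

lemma tw_comm (i j : Fin k) (z : Ch (Pt k D)) : tw i (tw j z) = tw j (tw i z) := by
  simp only [tw_apply, map_add, mapC_mapC, T_comm i j]
  abel

def cpt (d : Fin k →₀ ℕ) : Pt k D := fun i l => if (l : ℕ) = d i then 1 else 0

def phi (M : ℕ) (d : Fin k →₀ ℕ) (m : ℕ) (x : Pt k D) : Pt k D :=
  fun i l => (1 - (m : ℝ) / M) * x i l + ((m : ℝ) / M) * cpt (D := D) d i l

def HH (k D M : ℕ) : ℕ → (Fin k →₀ ℕ) → Ch (Pt k D)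
  | 0, d => Finsupp.single [cpt d] 1
  | n + 1, d => fill (phi M d) M (cpt d)
      (∑ i, if d i ≠ 0 then tw i (HH k D M n (d - Finsupp.single i 1)) else 0)

lemma sum_sum_symm {V : Type*} [AddCommGroup V] (hV : ∀ v : V, v + v = 0) {ι : Type*} [Fintype ι]
    [DecidableEq ι] (G : ι → ι → V) (hs : ∀ i j, G i j = G j i) (hd : ∀ i, G i i = 0) :
    ∑ i, ∑ j, G i j = 0 := by
  rw [← Fintype.sum_prod_type']
  refine Finset.sum_involution (fun p _ => p.swap) ?_ ?_ ?_ ?_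
  · rintro ⟨i, j⟩ _
    simp only [Prod.swap]
    rw [hs j i]; exact hV _
  · rintro ⟨i, j⟩ _ h1 h2
    simp only [Prod.swap, Prod.mk.injEq] at h2
    rw [h2.1] at h1
    exact h1 (hd _)
  · simp
  · simp

lemma phi_zero (M : ℕ) (d : Fin k →₀ ℕ) : phi (D := D) M d 0 = id := by
  funext x i l; simp [phi]

lemma bd_HH_zero (M : ℕ) (d : Fin k →₀ ℕ) :
    bd (HH k D M 0 d) = Finsupp.single [] 1 := by
  simp [HH, bdL]

lemma bd_HH (M : ℕ) (n : ℕ) : ∀ d : Fin k →₀ ℕ,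
    bd (HH k D M (n + 1) d) =
      ∑ i, if d i ≠ 0 then tw i (HH k D M n (d - Finsupp.single i 1)) else 0 := by
  induction n with
  | zero =>
    intro d
    rw [HH, bd_fill _ _ _ _ (phi_zero _ _)]
    rw [map_sum]
    refine Finset.sum_eq_zero fun i _ => ?_
    split_ifs
    · rw [bd_tw, bd_HH_zero, tw_apply]; simp [ch_add_self]
    · simp
  | succ n ih =>
    intro d
    rw [HH, bd_fill _ _ _ _ (phi_zero _ _)]
    rw [map_sum]
    refine Eq.trans ?_ (sum_sum_symm (V := Ch (Pt k D)) ch_add_self (ι := Fin k)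
      (fun i j => if Finsupp.single i 1 + Finsupp.single j 1 ≤ d then
        tw i (tw j (HH k D M n (d - (Finsupp.single i 1 + Finsupp.single j 1)))) else 0) ?_ ?_)
    · refine Finset.sum_congr rfl fun i _ => ?_
      by_cases hi : d i ≠ 0
      · rw [if_pos hi, bd_tw, ih, map_sum]
        refine Finset.sum_congr rfl fun j _ => ?_
        have key : (d - Finsupp.single i 1 : Fin k →₀ ℕ) j ≠ 0 ↔
            Finsupp.single i 1 + Finsupp.single j 1 ≤ d := by
          constructor
          · intro h x
            simp only [Finsupp.tsub_apply, Finsupp.add_apply, Finsupp.single_apply] at h ⊢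
            by_cases h1 : i = x <;> by_cases h2 : j = x
            · subst h1; subst h2; simp at h ⊢; omega
            · subst h1; simp [h2]; omega
            · subst h2; simp [h1] at h ⊢; omega
            · simp [h1, h2]
          · intro h
            have := h j
            simp only [Finsupp.tsub_apply, Finsupp.add_apply, Finsupp.single_apply] at this ⊢
            simp at this
            omega
        by_cases hj : (d - Finsupp.single i 1 : Fin k →₀ ℕ) j ≠ 0
        · rw [if_pos hj, if_pos (key.1 hj), tsub_tsub]
        · rw [if_neg hj, if_neg (fun h => hj (key.2 h)), map_zero]
      · rw [if_neg hi, map_zero]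
        symm
        refine Finset.sum_eq_zero fun j _ => if_neg fun h => hi ?_
        have := h i
        simp only [Finsupp.add_apply, Finsupp.single_apply] at this
        simp at this
        omega
    · intro i j
      rw [add_comm (Finsupp.single i 1), tw_comm]
    · intro i
      split_ifs
      · exact tw_tw _ _
      · rfl

/-- region for points of the chains -/
def Bset (k D n : ℕ) (d : Fin k →₀ ℕ) : Set (Pt k D) :=
  {v | ∀ i, (∀ l : Fin (D + 1), d i < l → v i l = 0) ∧ (∀ l : Fin (D + 1), (l : ℕ) = d i → 0 ≤ v i l)
    ∧ (∃ l, (1 / 2 : ℝ) ^ n ≤ |v i l|) ∧ ∀ l, |v i l| ≤ 1}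

def Sset (k D M n : ℕ) (d : Fin k →₀ ℕ) : Set (List (Pt k D)) :=
  {L | L.length = n + 1 ∧ (∀ v ∈ L, v ∈ Bset k D n d) ∧
    ∀ v ∈ L, ∀ w ∈ L, ∀ i l, |v i l - w i l| ≤ n * (2 / M)}

lemma cpt_mem (n : ℕ) (d : Fin k →₀ ℕ) (hd : ∀ i, d i ≤ D) : cpt d ∈ Bset k D n d := by
  intro i
  refine ⟨fun l hl => ?_, fun l hl => ?_, ⟨⟨d i, by have := hd i; omega⟩, ?_⟩, fun l => ?_⟩
  · simp [cpt]; omega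
  · simp [cpt]; split_ifs <;> norm_num
  · simp [cpt]; exact inv_le_one_of_one_le₀ (one_le_pow₀ (by norm_num))
  · simp only [cpt]; split_ifs <;> norm_num

/-- weaker region containing the boundary -/
lemma phi_mem (M n m : ℕ) (hm : m ≤ M) (hM : 0 < M) (d : Fin k →₀ ℕ) (hd : ∀ i, d i ≤ D)
    (x : Pt k D) (hx : x ∈ Bset k D n d) : phi M d m x ∈ Bset k D (n + 1) d := by
  have hM' : (0 : ℝ) < M := by exact_mod_cast hM
  have hs0 : 0 ≤ (m : ℝ) / M := by positivity
  have hs1 : (m : ℝ) / M ≤ 1 := by rw [div_le_one hM']; exact_mod_cast hm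
  have hp : (0 : ℝ) < (1 / 2 : ℝ) ^ n := by positivity
  have hp1 : (1 / 2 : ℝ) ^ n ≤ 1 := pow_le_one₀ (by norm_num) (by norm_num)
  intro i
  obtain ⟨h1, h2, ⟨l0, h3⟩, h4⟩ := hx i
  simp only [phi]
  generalize (m : ℝ) / M = s at *
  refine ⟨fun l hl => ?_, fun l hl => ?_, ?_, fun l => ?_⟩
  · simp only [cpt]; rw [h1 l hl, if_neg (by omega)]; simp
  · simp only [cpt]; rw [if_pos hl]
    have := h2 l hl
    nlinarith
  · rw [pow_succ]
    by_cases hs : s ≤ 1 / 2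
    · refine ⟨l0, ?_⟩
      by_cases hl : (l0 : ℕ) = d i
      · have h5 := h2 l0 hl
        rw [abs_of_nonneg h5] at h3
        simp only [cpt]; rw [if_pos hl, abs_of_nonneg (by nlinarith)]
        nlinarith
      · simp only [cpt]; rw [if_neg hl, mul_zero, add_zero, abs_mul, abs_of_nonneg (by linarith)]
        nlinarith
    · refine ⟨⟨d i, by have := hd i; omega⟩, ?_⟩
      have h5 := h2 ⟨d i, by have := hd i; omega⟩ rfl
      simp only [cpt, if_true]
      rw [abs_of_nonneg (by nlinarith)]
      nlinarith
  · have h5 : |cpt (D := D) d i l| ≤ 1 := by simp only [cpt]; split_ifs <;> norm_num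
    have h6 := abs_le.1 (h4 l)
    have h7 := abs_le.1 h5
    rw [abs_le]; constructor <;> nlinarith

lemma phi_dist (M m m' : ℕ) (hm : m ≤ M) (hm' : m' ≤ M) (hM : 0 < M) (h : |(m : ℝ) - m'| ≤ 1)
    (d : Fin k →₀ ℕ) (x y : Pt k D) (i : Fin k) (l : Fin (D + 1)) (η : ℝ)
    (hxy : |x i l - y i l| ≤ η) (hy : |y i l| ≤ 1) :
    |phi M d m x i l - phi M d m' y i l| ≤ η + 2 / M := by
  have hM' : (0 : ℝ) < M := by exact_mod_cast hM
  have hs0 : 0 ≤ (m : ℝ) / M := by positivity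
  have hs1 : (m : ℝ) / M ≤ 1 := by rw [div_le_one hM']; exact_mod_cast hm
  have hc : |cpt (D := D) d i l - y i l| ≤ 2 := by
    have h5 : |cpt (D := D) d i l| ≤ 1 := by simp only [cpt]; split_ifs <;> norm_num
    calc _ ≤ |cpt (D := D) d i l| + |y i l| := abs_sub _ _
      _ ≤ 2 := by linarith
  have e : phi M d m x i l - phi M d m' y i l =
      (1 - (m : ℝ) / M) * (x i l - y i l) + ((m - m') / M) * (cpt (D := D) d i l - y i l) := by
    simp only [phi]; field_simp; ring
  rw [e]
  refine (abs_add_le _ _).trans (add_le_add ?_ ?_)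
  · rw [abs_mul, abs_of_nonneg (by linarith)]
    have := abs_nonneg (x i l - y i l)
    nlinarith
  · rw [abs_mul, abs_div, abs_of_pos hM']
    calc |(m : ℝ) - m'| / M * |cpt (D := D) d i l - y i l| ≤ 1 / M * 2 := by gcongr
      _ = 2 / M := by ring

lemma Bset_lower (n : ℕ) (d : Fin k →₀ ℕ) (j : Fin k) (hj : d j ≠ 0)
    (v : Pt k D) (hv : v ∈ Bset k D n (d - Finsupp.single j 1)) :
    v ∈ Bset k D n d ∧ T j v ∈ Bset k D n d := by
  have key : ∀ i, i ≠ j → (d - Finsupp.single j 1 : Fin k →₀ ℕ) i = d i := by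
    intro i hi; simp [Finsupp.single_apply, hi.symm]
  have keyj : (d - Finsupp.single j 1 : Fin k →₀ ℕ) j = d j - 1 := by simp
  have c : ∀ (i : Fin k) (w : Pt k D), (w i = v i ∨ (i = j ∧ w i = - v i)) →
      (∀ l : Fin (D + 1), d i < l → w i l = 0) ∧ (∀ l : Fin (D + 1), (l : ℕ) = d i → 0 ≤ w i l)
      ∧ (∃ l, (1 / 2 : ℝ) ^ n ≤ |w i l|) ∧ ∀ l, |w i l| ≤ 1 := by
    intro i w hw
    obtain ⟨h1, h2, h3, h4⟩ := hv i
    have habs : ∀ l, |w i l| = |v i l| := by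
      intro l; rcases hw with hw | ⟨_, hw⟩ <;> simp [hw]
    have hz : ∀ l, v i l = 0 → w i l = 0 := by
      intro l h; rw [← abs_eq_zero, habs, h, abs_zero]
    simp only [habs]
    refine ⟨fun l hl => hz l (h1 l ?_), fun l hl => ?_, h3, h4⟩
    · by_cases hi : i = j
      · subst hi; rw [keyj]; omega
      · rw [key i hi]; exact hl
    · by_cases hi : i = j
      · subst hi; rw [hz l (h1 l (by rw [keyj]; omega))]
      · rw [key i hi] at h2
        rcases hw with hw | ⟨h, _⟩
        · rw [hw]; exact h2 l hl
        · exact absurd h hi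
  refine ⟨fun i => c i v (Or.inl rfl), fun i => c i _ ?_⟩
  by_cases hi : i = j
  · subst hi; right; simp [T]
  · left; simp [T, hi]

lemma HH_mem (M : ℕ) (hM : 0 < M) (n : ℕ) : ∀ d : Fin k →₀ ℕ, (∀ i, d i ≤ D) →
    HH k D M n d ∈ Finsupp.supported (ZMod 2) (ZMod 2) (Sset k D M n d) := by
  induction n with
  | zero =>
    intro d hd
    refine Finsupp.single_mem_supported _ _ ⟨by simp, ?_, ?_⟩
    · intro v hv
      rw [List.mem_singleton] at hv
      rw [hv]; exact cpt_mem _ _ hd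
    · intro v hv w hw i l
      rw [List.mem_singleton] at hv hw
      simp [hv, hw]
  | succ n ih =>
    intro d hd
    have hz : (∑ i, if d i ≠ 0 then tw i (HH k D M n (d - Finsupp.single i 1)) else 0) ∈
        Finsupp.supported (ZMod 2) (ZMod 2) {L : List (Pt k D) | L.length = n + 1 ∧
          (∀ v ∈ L, v ∈ Bset k D n d) ∧
          ∀ v ∈ L, ∀ w ∈ L, ∀ i l, |v i l - w i l| ≤ n * (2 / M)} := by
      refine Submodule.sum_mem _ fun j _ => ?_
      split_ifs with hj
      · refine lin_mem ?_ (ih (d - Finsupp.single j 1) fun i => le_trans (by simp) (hd i))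
        rintro L ⟨h1, h2, h3⟩
        rw [tw_apply, mapC_single]
        refine Submodule.add_mem _ (Finsupp.single_mem_supported _ _ ?_)
          (Finsupp.single_mem_supported _ _ ?_)
        · exact ⟨h1, fun v hv => (Bset_lower n d j hj v (h2 v hv)).1, h3⟩
        · refine ⟨by simpa using h1, ?_, ?_⟩
          · intro v hv
            obtain ⟨u, hu, rfl⟩ := List.mem_map.1 hv
            exact (Bset_lower n d j hj u (h2 u hu)).2
          · intro v hv w hw i l
            obtain ⟨u, hu, rfl⟩ := List.mem_map.1 hv
            obtain ⟨u', hu', rfl⟩ := List.mem_map.1 hw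
            have := h3 u hu u' hu' i l
            by_cases hi : i = j
            · subst hi
              simp only [T, Function.update_self, Pi.neg_apply]
              rw [show -u i l - -u' i l = -(u i l - u' i l) by ring, abs_neg]; exact this
            · simpa [T, hi] using this
      · exact Submodule.zero_mem _
    rw [HH]
    generalize (∑ i, if d i ≠ 0 then tw i (HH k D M n (d - Finsupp.single i 1)) else 0) = z at hz
    rw [fill]
    refine Submodule.add_mem _ (Submodule.sum_mem _ fun m hm => ?_) ?_
    · rw [Finset.mem_range] at hm
      refine lin_mem ?_ hz
      rintro L ⟨h1, h2, h3⟩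
      rw [pr_single]
      refine Finsupp.supported_mono ?_ (prL_mem _ _ L)
      rintro L' ⟨g1, g2⟩
      have g3 : ∀ u ∈ L', ∃ v ∈ L, ∃ m', (m' = m ∨ m' = m + 1) ∧ u = phi M d m' v := by
        intro u hu
        obtain ⟨v, hv, h | h⟩ := g2 u hu
        · exact ⟨v, hv, m, Or.inl rfl, h⟩
        · exact ⟨v, hv, m + 1, Or.inr rfl, h⟩
      refine ⟨by rw [g1, h1], ?_, ?_⟩
      · intro u hu
        obtain ⟨v, hv, m', hm', rfl⟩ := g3 u hu
        exact phi_mem M n m' (by omega) hM d hd v (h2 v hv)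
      · intro u hu w hw i l
        obtain ⟨v, hv, m', hm', rfl⟩ := g3 u hu
        obtain ⟨v', hv', m'', hm'', rfl⟩ := g3 w hw
        have := phi_dist M m' m'' (by omega) (by omega) hM ?_ d v v' i l _ (h3 v hv v' hv' i l)
          ((h2 v' hv' i).2.2.2 l)
        · push_cast; linarith
        · rcases hm' with rfl | rfl <;> rcases hm'' with rfl | rfl <;> simp
    · have hM' : (M : ℝ) ≠ 0 := by exact_mod_cast hM.ne'
      have hc : ∀ v : Pt k D, phi M d M v = cpt d := by
        intro v; funext i l; simp [phi, div_self hM']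
      have : ∀ z, consC (cpt d) (mapC (phi M d M) z) =
          (consC (cpt d) ∘ₗ mapC (phi (D := D) M d M)) z := fun _ => rfl
      rw [this]
      refine lin_mem ?_ hz
      rintro L ⟨h1, h2, h3⟩
      simp only [LinearMap.comp_apply, mapC_single, consC_single]
      have g : ∀ u ∈ cpt d :: L.map (phi M d M), u = cpt (D := D) d := by
        intro u hu
        rcases List.mem_cons.1 hu with h | h
        · exact h
        · obtain ⟨v, _, rfl⟩ := List.mem_map.1 h
          exact hc v
      refine Finsupp.single_mem_supported _ _ ⟨by simp [h1], ?_, ?_⟩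
      · intro u hu
        rw [g u hu]; exact cpt_mem _ _ hd
      · intro u hu w hw i l
        rw [g u hu, g w hw]
        simp; positivity

end build

section bu
variable {k D : ℕ}

def good (k D : ℕ) : Set (Pt k D) := {x | ∀ i, x i ≠ 0}

lemma Bset_good (n : ℕ) (d : Fin k →₀ ℕ) : Bset k D n d ⊆ good k D := by
  intro v hv i h
  obtain ⟨_, _, ⟨l, hl⟩, _⟩ := hv i
  rw [h] at hl
  have : (0 : ℝ) < (1 / 2) ^ n := by positivity
  simp only [Pi.zero_apply, abs_zero] at hl
  linarith

def lin (α : Fin k → ZMod 2) : MvPolynomial (Fin k) (ZMod 2) :=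
  ∑ i, MvPolynomial.C (α i) * MvPolynomial.X i

lemma eval_HH (M : ℕ) (hM : 0 < M) (S : List ((Pt k D → ZMod 2) × (Fin k → ZMod 2))) :
    (∀ p ∈ S, ∀ i, ∀ x ∈ good k D, p.1 (T i x) = p.1 x + p.2 i) →
    ∀ d : Fin k →₀ ℕ, d.degree = S.length → (∀ i, d i ≤ D) →
    ext (E (S.map Prod.fst)) (HH k D M S.length d) =
      MvPolynomial.coeff d (S.map fun p => lin p.2).prod := by
  induction S with
  | nil =>
    intro _ d hd _
    have : d = 0 := (Finsupp.degree_eq_zero_iff d).1 (by simpa using hd)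
    subst this
    simp [HH, E]
  | cons p S ih =>
    intro hS d hd hD
    have hS' : ∀ p ∈ S, ∀ i, ∀ x ∈ good k D, p.1 (T i x) = p.1 x + p.2 i :=
      fun p hp => hS p (by simp [hp])
    have hmem := HH_mem M hM (S.length + 1) d hD
    have e1 : ext (E ((p :: S).map Prod.fst)) (HH k D M (p :: S).length d) =
        ext (A p.1 (S.map Prod.fst)) (bd (HH k D M (S.length + 1) d)) := by
      have := lin_eq_on (f := ext (E ((p :: S).map Prod.fst)))
        (g := ext (A p.1 (S.map Prod.fst)) ∘ₗ bd) ?_ hmem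
      · simpa using this
      · rintro L ⟨h1, -, -⟩
        simp only [LinearMap.comp_apply, bd_single, ext_single, List.map_cons]
        rw [A_bd]
        simpa using h1
    rw [e1, bd_HH, map_sum]
    simp only [List.map_cons, List.prod_cons]
    rw [lin, Finset.sum_mul, MvPolynomial.coeff_sum]
    refine Finset.sum_congr rfl fun i _ => ?_
    rw [mul_assoc, MvPolynomial.coeff_C_mul, MvPolynomial.coeff_X_mul']
    by_cases hi : d i ≠ 0
    · rw [if_pos hi, if_pos (by simpa using hi)]
      have hD' : ∀ j, (d - Finsupp.single i 1 : Fin k →₀ ℕ) j ≤ D :=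
        fun j => le_trans (by simp) (hD j)
      rw [← ih hS' (d - Finsupp.single i 1) ?_ hD']
      · have := lin_eq_on (f := ext (A p.1 (S.map Prod.fst)) ∘ₗ tw i)
          (g := p.2 i • ext (E (S.map Prod.fst))) ?_
          (HH_mem M hM S.length (d - Finsupp.single i 1) hD')
        · simpa using this
        · rintro L ⟨h1, h2, -⟩
          simp only [LinearMap.comp_apply, tw_apply, map_add, mapC_single, ext_single,
            LinearMap.smul_apply, smul_eq_mul]
          rcases L with (_ | ⟨v, L⟩)
          · simp at h1
          have hg : ∀ v' ∈ v :: L, v' ∈ good k D := fun v' hv' => Bset_good _ _ (h2 v' hv')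
          have := E_map (T i) (good k D) (S.map Prod.fst) ?_ (v :: L) hg
          · simp only [List.map_cons] at this
            simp only [List.map_cons, A]
            rw [this, hS p (by simp) i v (hg v (by simp))]
            have h2 : ∀ a : ZMod 2, a + a = 0 := CharTwo.add_self_eq_zero
            linear_combination (E (S.map Prod.fst) (v :: L)) * h2 (p.1 v)
          · intro s hs
            obtain ⟨p', hp', rfl⟩ := List.mem_map.1 hs
            exact ⟨p'.2 i, hS' p' hp' i⟩
      · have : d = (d - Finsupp.single i 1) + Finsupp.single i 1 := by
          rw [tsub_add_cancel_of_le]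
          rw [Finsupp.single_le_iff]; omega
        rw [this] at hd
        simp only [map_add, Finsupp.degree_single, List.length_cons] at hd
        omega
    · rw [if_neg hi, if_neg (by simpa using hi), map_zero, mul_zero]

open Classical in
def lexs (u : Fin (D + 1) → ℝ) : ZMod 2 := if 0 < toLex u then 1 else 0

lemma lexs_neg (u : Fin (D + 1) → ℝ) (hu : u ≠ 0) : lexs (-u) = lexs u + 1 := by
  have h0 : toLex u ≠ 0 := fun h => hu (by simpa using h)
  have h1 : (0 < toLex (-u)) ↔ toLex u < 0 := by
    rw [show toLex (-u) = - toLex u from rfl]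
    exact neg_pos
  unfold lexs
  rcases lt_or_gt_of_ne h0 with h | h
  · have h2 : ¬ (0 < toLex u) := lt_asymm h
    rw [if_pos (h1.2 h), if_neg h2]; rfl
  · have h2 : 0 < toLex u := h
    have h3 : ¬ (0 < toLex (-u)) := fun h' => lt_asymm h (h1.1 h')
    rw [if_pos h2, if_neg h3]; decide

def sg (f : Pt k D → ℝ) (α : Fin k → ZMod 2) (x : Pt k D) : ZMod 2 :=
  if 0 < f x then 1 else if f x < 0 then 0 else ∑ i, α i * lexs (x i)

lemma sg_T (f : Pt k D → ℝ) (α : Fin k → ZMod 2)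
    (hf : ∀ x ∈ good k D, ∀ i, f (T i x) = if α i = 0 then f x else - f x)
    (i : Fin k) (x : Pt k D) (hx : x ∈ good k D) : sg f α (T i x) = sg f α x + α i := by
  have hα : α i = 0 ∨ α i = 1 := by generalize α i = a; revert a; decide
  have hT : ∑ j, α j * lexs (T i x j) = ∑ j, α j * lexs (x j) + α i := by
    have : ∀ j, α j * lexs (T i x j) = α j * lexs (x j) + if j = i then α i else 0 := by
      intro j
      by_cases hj : j = i
      · subst hj
        simp only [T, Function.update_self, lexs_neg _ (hx j), if_true]; ring
      · simp [T, hj]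
    simp only [this, Finset.sum_add_distrib]
    simp
  have h11 : (1 + 1 : ZMod 2) = 0 := by decide
  unfold sg
  rw [hT, hf x hx i]
  rcases hα with h | h
  · simp [h]
  · have hne : ¬ (α i = 0) := by rw [h]; decide
    rw [if_neg hne]
    rcases lt_trichotomy (f x) 0 with h' | h' | h'
    · rw [if_pos (by linarith), if_neg (by linarith), if_pos h', h, zero_add]
    · rw [h']; simp
    · rw [if_neg (by linarith), if_pos (by linarith), if_pos h', h, h11]

lemma sg_ne (f : Pt k D → ℝ) (α : Fin k → ZMod 2) (x y : Pt k D) (h : sg f α x ≠ sg f α y) :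
    f x * f y ≤ 0 := by
  by_contra hc
  push Not at hc
  apply h
  rcases pos_and_pos_or_neg_and_neg_of_mul_pos hc with ⟨h1, h2⟩ | ⟨h1, h2⟩
  · simp [sg, h1, h2]
  · simp [sg, h1, h2, h1.le.not_gt, h2.le.not_gt]

lemma lin_homog (S : List (Fin k → ZMod 2)) : (S.map lin).prod.IsHomogeneous S.length := by
  induction S with
  | nil => simpa using MvPolynomial.isHomogeneous_one _ _
  | cons α S ih =>
    simp only [List.map_cons, List.prod_cons, List.length_cons]
    rw [add_comm]
    refine MvPolynomial.IsHomogeneous.mul ?_ ih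
    refine MvPolynomial.IsHomogeneous.sum _ _ _ fun i _ => ?_
    simpa using (MvPolynomial.isHomogeneous_C (Fin k) (α i)).mul (MvPolynomial.isHomogeneous_X _ i)

/-- Borsuk–Ulam type theorem for products of spheres. -/
theorem borsuk_ulam_prod (S : List ((Pt k D → ℝ) × (Fin k → ZMod 2)))
    (hc : ∀ p ∈ S, ∀ x ∈ good k D, ContinuousAt p.1 x)
    (hT : ∀ p ∈ S, ∀ x ∈ good k D, ∀ i, p.1 (T i x) = if p.2 i = 0 then p.1 x else - p.1 x)
    (d : Fin k →₀ ℕ) (hD : ∀ i, d i ≤ D)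
    (hcoeff : MvPolynomial.coeff d (S.map fun p => lin p.2).prod ≠ 0) :
    ∃ x ∈ good k D, ∀ p ∈ S, p.1 x = 0 := by
  have hdeg : d.degree = S.length := by
    by_contra h
    have := (lin_homog (S.map Prod.snd)).coeff_eq_zero (d := d) (by simpa using h)
    apply hcoeff
    simpa [Function.comp_def] using this
  set n := S.length with hn
  -- small tuples
  have step : ∀ M : ℕ, ∃ L : List (Pt k D), L ∈ Sset k D (M + 1) n d ∧
      ∀ p ∈ S, ∃ u ∈ L, ∃ w ∈ L, p.1 u * p.1 w ≤ 0 := by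
    intro M
    set S' : List ((Pt k D → ZMod 2) × (Fin k → ZMod 2)) :=
      S.map (fun p => (sg p.1 p.2, p.2)) with hS'
    have h1 := eval_HH (M + 1) (Nat.succ_pos M) S' ?_ d (by simp [hS', hdeg, hn]) hD
    · have h2 : ext (E (S'.map Prod.fst)) (HH k D (M + 1) S'.length d) ≠ 0 := by
        rw [h1]; simpa [hS', Function.comp_def] using hcoeff
      by_contra hcon
      push Not at hcon
      apply h2
      have h3 := HH_mem (k := k) (M + 1) (Nat.succ_pos M) S'.length d hD
      have := lin_eq_on (f := ext (E (S'.map Prod.fst))) (g := 0) ?_ h3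
      · simpa using this
      · intro L hL
        rw [ext_single, LinearMap.zero_apply]
        by_contra hne
        have hL' : L ∈ Sset k D (M + 1) n d := by simpa [hS', ← hn] using hL
        obtain ⟨p, hp, hpp⟩ := hcon L hL'
        obtain ⟨u, hu, w, hw, huw⟩ := E_ne_zero _ L hne (sg p.1 p.2) (by
          simp only [hS', List.map_map, List.mem_map]
          exact ⟨p, hp, rfl⟩)
        exact absurd (sg_ne _ _ _ _ huw) (not_le.2 (hpp u hu w hw))
    · intro p hp i x hx
      obtain ⟨p', hp', rfl⟩ := List.mem_map.1 hp
      exact sg_T p'.1 p'.2 (hT p' hp') i x hx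
  choose L hL hsign using step
  -- compactness
  set K : Set (Pt k D) := {v | ∀ i, (∃ l, (1 / 2 : ℝ) ^ n ≤ |v i l|) ∧ ∀ l, |v i l| ≤ 1} with hK
  have hBK : ∀ v ∈ Bset k D n d, v ∈ K := fun v hv i => ⟨(hv i).2.2.1, (hv i).2.2.2⟩
  have hKgood : ∀ v ∈ K, v ∈ good k D := by
    intro v hv i h
    obtain ⟨⟨l, hl⟩, _⟩ := hv i
    rw [h] at hl
    have : (0 : ℝ) < (1 / 2) ^ n := by positivity
    simp only [Pi.zero_apply, abs_zero] at hl
    linarith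
  have hKc : IsCompact K := by
    refine Metric.isCompact_of_isClosed_isBounded ?_ ?_
    · rw [hK]
      have : {v : Pt k D | ∀ i, (∃ l, (1 / 2 : ℝ) ^ n ≤ |v i l|) ∧ ∀ l, |v i l| ≤ 1} =
          ⋂ i, ((⋃ l, {v : Pt k D | (1 / 2 : ℝ) ^ n ≤ |v i l|}) ∩ ⋂ l, {v : Pt k D | |v i l| ≤ 1}) := by
        ext v; simp
      rw [this]
      refine isClosed_iInter fun i => IsClosed.inter (isClosed_iUnion_of_finite fun l => ?_)
        (isClosed_iInter fun l => ?_)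
      · exact isClosed_le continuous_const (by fun_prop)
      · exact isClosed_le (by fun_prop) continuous_const
    · refine Bornology.IsBounded.subset (Metric.isBounded_closedBall (x := (0 : Pt k D)) (r := 1)) ?_
      intro v hv
      rw [mem_closedBall_zero_iff, pi_norm_le_iff_of_nonneg zero_le_one]
      intro i
      rw [pi_norm_le_iff_of_nonneg zero_le_one]
      exact (hv i).2
  have hne : ∀ M, ∃ v, v ∈ L M := fun M =>
    List.exists_mem_of_length_pos (by rw [(hL M).1]; omega)
  choose P hP using hne
  obtain ⟨x, hxK, ψ, hψ, hlim⟩ := hKc.tendsto_subseq (x := P)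
    (fun M => hBK _ ((hL M).2.1 _ (hP M)))
  have hlimall : ∀ Q : ℕ → Pt k D, (∀ M, Q M ∈ L M) →
      Filter.Tendsto (Q ∘ ψ) Filter.atTop (nhds x) := by
    intro Q hQ
    rw [tendsto_pi_nhds]; intro i
    rw [tendsto_pi_nhds]; intro l
    have h1 : Filter.Tendsto (fun j => (P ∘ ψ) j i l) Filter.atTop (nhds (x i l)) :=
      (tendsto_pi_nhds.1 ((tendsto_pi_nhds.1 hlim) i)) l
    have h2 : Filter.Tendsto (fun M : ℕ => (n : ℝ) * (2 / ((M : ℝ) + 1))) Filter.atTop (nhds 0) := by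
      have := (tendsto_one_div_add_atTop_nhds_zero_nat (𝕜 := ℝ)).const_mul ((n : ℝ) * 2)
      rw [mul_zero] at this
      refine this.congr fun M => ?_
      ring
    have h3 : Filter.Tendsto (fun j => (Q ∘ ψ) j i l - (P ∘ ψ) j i l) Filter.atTop (nhds 0) := by
      refine squeeze_zero_norm (fun j => ?_) (h2.comp hψ.tendsto_atTop)
      have := (hL (ψ j)).2.2 _ (hQ (ψ j)) _ (hP (ψ j)) i l
      simpa using this
    have := h3.add h1
    simpa using this
  refine ⟨x, hKgood x hxK, fun p hp => ?_⟩
  have hu : ∀ M, ∃ u ∈ L M, ∃ w ∈ L M, p.1 u * p.1 w ≤ 0 := fun M => hsign M p hp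
  choose u hu w hw huw using hu
  have hcx := hc p hp x (hKgood x hxK)
  have t1 : Filter.Tendsto (fun j => p.1 (u (ψ j))) Filter.atTop (nhds (p.1 x)) :=
    hcx.tendsto.comp (hlimall u hu)
  have t2 : Filter.Tendsto (fun j => p.1 (w (ψ j))) Filter.atTop (nhds (p.1 x)) :=
    hcx.tendsto.comp (hlimall w hw)
  have t3 := le_of_tendsto' (t1.mul t2) (fun j => huw (ψ j))
  exact mul_self_eq_zero.1 (le_antisymm t3 (mul_self_nonneg _))

end bu

section algebra
open MvPolynomial

def VV (R : Type*) [CommRing R] {n K : ℕ} (ι : Fin n → Fin K) : MvPolynomial (Fin K) R :=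
  (∏ j, X (ι j)) * ∏ i, ∏ j ∈ Finset.Ioi i, (X (ι j) - X (ι i))

def ee {n K : ℕ} (ι : Fin n → Fin K) (σ : Equiv.Perm (Fin n)) : Fin K →₀ ℕ :=
  ∑ j, Finsupp.single (ι j) ((σ j : ℕ) + 1)

lemma ee_apply {n K : ℕ} (ι : Fin n → Fin K) (hι : Function.Injective ι)
    (σ : Equiv.Perm (Fin n)) (j : Fin n) : ee ι σ (ι j) = (σ j : ℕ) + 1 := by
  simp [ee, Finsupp.finsetSum_apply, Finsupp.single_apply, hι.eq_iff, Finset.sum_add_distrib]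

lemma ee_apply_of {n K : ℕ} (ι : Fin n → Fin K)
    (σ : Equiv.Perm (Fin n)) (i : Fin K) (hi : ∀ j, ι j ≠ i) : ee ι σ i = 0 := by
  simp [ee, Finsupp.finsetSum_apply, Finsupp.single_apply, hi]

lemma VV_det (R : Type*) [CommRing R] {n K : ℕ} (ι : Fin n → Fin K) :
    VV R ι = (∏ j, X (ι j)) * (Matrix.vandermonde fun j => (X (ι j) : MvPolynomial (Fin K) R)).det := by
  rw [Matrix.det_vandermonde]; rfl

lemma VV_sum (R : Type*) [CommRing R] {n K : ℕ} (ι : Fin n → Fin K) :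
    VV R ι = ∑ σ : Equiv.Perm (Fin n), Equiv.Perm.sign σ • monomial (ee ι σ) (1 : R) := by
  rw [VV_det, Matrix.det_apply, Finset.mul_sum]
  rw [← Equiv.sum_comp (Equiv.inv (Equiv.Perm (Fin n)))]
  refine Finset.sum_congr rfl fun σ _ => ?_
  simp only [Equiv.inv_apply, Equiv.Perm.sign_inv]
  rw [mul_smul_comm]
  congr 1
  rw [← Equiv.prod_comp σ (fun i => (Matrix.vandermonde fun j => (X (ι j) : MvPolynomial (Fin K) R))
    (σ⁻¹ i) i), ← Finset.prod_mul_distrib, ee, monomial_sum_one]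
  refine Finset.prod_congr rfl fun j _ => ?_
  have hinv : σ⁻¹ (σ j) = j := by simp
  simp only [Matrix.vandermonde_apply, hinv]
  rw [← pow_succ', X_pow_eq_monomial]

lemma VV_coeff_ne {R : Type*} [CommRing R] {n K : ℕ} (ι : Fin n → Fin K) (e : Fin K →₀ ℕ)
    (h : coeff e (VV R ι) ≠ 0) : ∃ σ, e = ee ι σ := by
  by_contra hc
  push Not at hc
  apply h
  rw [VV_sum, coeff_sum]
  refine Finset.sum_eq_zero fun σ _ => ?_
  rw [Units.smul_def, coeff_smul, coeff_monomial, if_neg (fun h => hc σ h.symm), smul_zero]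

lemma ee_inj {n K : ℕ} (ι : Fin n → Fin K) (hι : Function.Injective ι) :
    Function.Injective (ee ι) := by
  intro σ τ h
  ext j
  have := DFunLike.congr_fun h (ι j)
  rw [ee_apply ι hι, ee_apply ι hι] at this
  omega

lemma VV_coeff_ee {n K : ℕ} (ι : Fin n → Fin K) (hι : Function.Injective ι)
    (σ : Equiv.Perm (Fin n)) : coeff (ee ι σ) (VV (ZMod 2) ι) = 1 := by
  rw [VV_sum, coeff_sum, Finset.sum_eq_single σ]
  · rw [Units.smul_def, coeff_smul, coeff_monomial, if_pos rfl]
    rcases Int.units_eq_one_or (Equiv.Perm.sign σ) with h | h <;> rw [h] <;> decide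
  · intro τ _ hτ
    rw [Units.smul_def, coeff_smul, coeff_monomial, if_neg (fun h => hτ (ee_inj ι hι h)), smul_zero]
  · simp

abbrev Vp (R : Type*) [CommRing R] (m : ℕ) : MvPolynomial (Fin (m + 1)) R := VV R (Fin.succ)

def Rp (R : Type*) [CommRing R] (m : ℕ) : MvPolynomial (Fin (m + 1)) R :=
  X 0 * ∏ j : Fin m, (X 0 - X j.succ)

lemma map_Vp {R S : Type*} [CommRing R] [CommRing S] (f : R →+* S) (m : ℕ) :
    map f (Vp R m) = Vp S m := by
  simp [Vp, VV, map_prod]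

lemma map_Rp {R S : Type*} [CommRing R] [CommRing S] (f : R →+* S) (m : ℕ) :
    map f (Rp R m) = Rp S m := by
  simp [Rp, map_prod]

lemma Rp_mul_Vp (m : ℕ) : Rp (ZMod 2) m * Vp (ZMod 2) m = VV (ZMod 2) (id : Fin (m + 1) → _) := by
  simp only [Rp, Vp, VV, id]
  rw [Fin.prod_univ_succ (fun i => (X i : MvPolynomial (Fin (m + 1)) (ZMod 2)))]
  rw [Fin.prod_univ_succ (fun i : Fin (m + 1) => ∏ j ∈ Finset.Ioi i,
    (X j - X i : MvPolynomial (Fin (m + 1)) (ZMod 2)))]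
  rw [Fin.prod_Ioi_zero]
  simp only [Fin.prod_Ioi_succ]
  have : ∏ j : Fin m, (X 0 - X j.succ : MvPolynomial (Fin (m + 1)) (ZMod 2)) =
      ∏ j : Fin m, (X j.succ - X 0) := by
    refine Finset.prod_congr rfl fun j _ => ?_
    rw [← neg_sub, CharTwo.neg_eq]
  rw [this]; ring

lemma swap_succ {m : ℕ} (a b j : Fin m) :
    Equiv.swap a.succ b.succ j.succ = (Equiv.swap a b j).succ := by
  simp only [Equiv.swap_apply_def, Fin.succ_inj]
  split_ifs <;> rfl

lemma rename_Rp {m : ℕ} (a b : Fin m) :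
    rename (Equiv.swap a.succ b.succ) (Rp ℤ m) = Rp ℤ m := by
  have h0 : Equiv.swap a.succ b.succ 0 = 0 :=
    Equiv.swap_apply_of_ne_of_ne (Fin.succ_ne_zero a).symm (Fin.succ_ne_zero b).symm
  simp only [Rp, map_mul, map_prod, map_sub, rename_X, h0, swap_succ]
  congr 1
  exact Equiv.prod_comp (Equiv.swap a b) (fun j => (X 0 - X j.succ : MvPolynomial (Fin (m + 1)) ℤ))

lemma rename_Vp {m : ℕ} (a b : Fin m) (hab : a ≠ b) :
    rename (Equiv.swap a.succ b.succ) (Vp ℤ m) = - Vp ℤ m := by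
  rw [Vp, VV_det, map_mul, map_prod]
  simp only [rename_X, swap_succ]
  rw [Equiv.prod_comp (Equiv.swap a b) (fun j => (X j.succ : MvPolynomial (Fin (m + 1)) ℤ))]
  rw [← mul_neg]
  congr 1
  rw [← AlgHom.coe_toRingHom, RingHom.map_det]
  have : (RingHom.mapMatrix (rename (R := ℤ) (Equiv.swap a.succ b.succ)).toRingHom)
      (Matrix.vandermonde fun j : Fin m => (X j.succ : MvPolynomial (Fin (m + 1)) ℤ)) =
      (Matrix.vandermonde fun j : Fin m => (X j.succ : MvPolynomial (Fin (m + 1)) ℤ)).submatrix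
        (Equiv.swap a b) id := by
    ext i j : 2
    simp [Matrix.vandermonde_apply, swap_succ]
  have h2 := Matrix.det_permute (Equiv.swap a b)
    (Matrix.vandermonde fun j : Fin m => (X j.succ : MvPolynomial (Fin (m + 1)) ℤ))
  rw [← this, Equiv.Perm.sign_swap hab] at h2
  simpa using h2

lemma coeff_distinct {m : ℕ} (M N : ℕ) (hN : Odd N) (μ : Fin (m + 1) →₀ ℕ)
    (h : coeff μ (Rp (ZMod 2) m ^ M * Vp (ZMod 2) m ^ N) ≠ 0) (a b : Fin m) (hab : a ≠ b) :
    μ a.succ ≠ μ b.succ := by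
  intro heq
  apply h
  rw [← map_Vp (Int.castRingHom (ZMod 2)), ← map_Rp (Int.castRingHom (ZMod 2)), ← map_pow,
    ← map_pow, ← map_mul, coeff_map]
  have hπ : rename (Equiv.swap a.succ b.succ) (Rp ℤ m ^ M * Vp ℤ m ^ N) =
      - (Rp ℤ m ^ M * Vp ℤ m ^ N) := by
    rw [map_mul, map_pow, map_pow, rename_Rp, rename_Vp a b hab, hN.neg_pow, mul_neg]
  have hμ : μ.mapDomain (Equiv.swap a.succ b.succ) = μ := by
    ext i
    rw [Finsupp.mapDomain_equiv_apply, Equiv.symm_swap, Equiv.swap_apply_def]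
    split_ifs with h1 h2
    · rw [h1, heq]
    · rw [h2, heq]
    · rfl
  have h2 := coeff_rename_mapDomain (Equiv.swap a.succ b.succ) (Equiv.injective _)
    (Rp ℤ m ^ M * Vp ℤ m ^ N) μ
  rw [hμ, hπ, coeff_neg] at h2
  have : coeff μ (Rp ℤ m ^ M * Vp ℤ m ^ N) = 0 := by omega
  rw [this]; simp

lemma Vp_homog (m : ℕ) : (Vp (ZMod 2) m).IsHomogeneous (∑ j : Fin m, ((j : ℕ) + 1)) := by
  intro e he
  obtain ⟨σ, rfl⟩ := VV_coeff_ne _ _ he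
  have hdw : (Finsupp.weight 1) (ee Fin.succ σ) = (ee (Fin.succ : Fin m → _) σ).degree := by
    rw [Finsupp.degree_eq_weight_one]; rfl
  rw [hdw]
  simp only [ee, map_sum, Finsupp.degree_single]
  exact Equiv.sum_comp σ (fun j : Fin m => (j : ℕ) + 1)

lemma Rp_homog (m : ℕ) : (Rp (ZMod 2) m).IsHomogeneous (m + 1) := by
  have := IsHomogeneous.prod (Finset.univ : Finset (Fin m))
    (fun j : Fin m => (X 0 - X j.succ : MvPolynomial (Fin (m + 1)) (ZMod 2))) (fun _ => 1)
    (fun j _ => (isHomogeneous_X _ _).sub (isHomogeneous_X _ _))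
  have h2 := (isHomogeneous_X (ZMod 2) (0 : Fin (m + 1))).mul this
  have h3 : 1 + ∑ _j : Fin m, 1 = m + 1 := by simp [add_comm]
  rw [h3] at h2
  exact h2

/-- distinct positive integers with minimal sum -/
lemma perm_of_sum {m : ℕ} (w : Fin m → ℕ) (hw : Function.Injective w)
    (hs : ∑ j, w j ≤ ∑ j : Fin m, (j : ℕ)) : ∃ u : Equiv.Perm (Fin m), ∀ j, w j = u j := by
  set S : Finset ℕ := Finset.univ.image w with hS
  have hcard : S.card = m := by
    rw [hS, Finset.card_image_of_injective _ hw]; simp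
  set f := S.orderEmbOfFin hcard with hf
  have hle : ∀ i : Fin m, (i : ℕ) ≤ f i := by
    rintro ⟨i, hi⟩
    induction i with
    | zero => exact Nat.zero_le _
    | succ i ih =>
      have h1 := ih (by omega)
      have h2 : f ⟨i, by omega⟩ < f ⟨i + 1, hi⟩ := f.strictMono (by simp)
      simp only at h1 ⊢
      omega
  have hsum : ∑ i, f i = ∑ j, w j := by
    have h1 : ∑ i, f i = ∑ x ∈ Finset.univ.map f.toEmbedding, x := by simp
    have h2 : Finset.univ.map f.toEmbedding = S := by
      ext x
      have := Set.ext_iff.1 (Finset.range_orderEmbOfFin S hcard) x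
      simpa [hf] using this
    rw [h1, h2, hS, Finset.sum_image (fun a _ b _ h => hw h)]
  have heq : ∀ i ∈ (Finset.univ : Finset (Fin m)), ((i : Fin m) : ℕ) = f i := by
    rw [← Finset.sum_eq_sum_iff_of_le (fun i _ => hle i)]
    exact le_antisymm (Finset.sum_le_sum fun i _ => hle i) (hsum ▸ hs)
  have hlt : ∀ j, w j < m := by
    intro j
    have : w j ∈ Set.range f := by
      rw [Finset.range_orderEmbOfFin]; simp [hS]
    obtain ⟨i, hi⟩ := this
    rw [← hi, ← heq i (Finset.mem_univ _)]; exact i.2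
  refine ⟨Equiv.ofBijective (fun j => ⟨w j, hlt j⟩) ?_, fun j => rfl⟩
  rw [← Finite.injective_iff_bijective]
  intro a b h
  exact hw (by simpa using h)

lemma perm_avg {m : ℕ} (u σ : Equiv.Perm (Fin m)) (h : ∀ j, 2 * (u j : ℕ) = j + σ j) :
    ∀ j, u j = j := by
  have h1 : ∑ j, ((u j : ℕ) : ℤ) ^ 2 = ∑ j : Fin m, ((j : ℕ) : ℤ) ^ 2 :=
    Equiv.sum_comp u (fun j : Fin m => ((j : ℕ) : ℤ) ^ 2)
  have h2 : ∑ j, ((σ j : ℕ) : ℤ) ^ 2 = ∑ j : Fin m, ((j : ℕ) : ℤ) ^ 2 :=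
    Equiv.sum_comp σ (fun j : Fin m => ((j : ℕ) : ℤ) ^ 2)
  have h3 : ∑ j : Fin m, (((j : ℕ) : ℤ) - ((σ j : ℕ) : ℤ)) ^ 2 = 0 := by
    have : ∀ j : Fin m, (((j : ℕ) : ℤ) - ((σ j : ℕ) : ℤ)) ^ 2 =
        2 * ((j : ℕ) : ℤ) ^ 2 + 2 * ((σ j : ℕ) : ℤ) ^ 2 - 4 * ((u j : ℕ) : ℤ) ^ 2 := by
      intro j
      have : (2 : ℤ) * ((u j : ℕ) : ℤ) = ((j : ℕ) : ℤ) + ((σ j : ℕ) : ℤ) := by exact_mod_cast h j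
      have e : 4 * ((u j : ℕ) : ℤ) ^ 2 = (2 * ((u j : ℕ) : ℤ)) ^ 2 := by ring
      rw [e, this]; ring
    simp only [this, Finset.sum_sub_distrib, Finset.sum_add_distrib, ← Finset.mul_sum, h1, h2]
    ring
  intro j
  have h4 := (Finset.sum_eq_zero_iff_of_nonneg (fun j _ => sq_nonneg _)).1 h3 j (Finset.mem_univ _)
  have h5 : ((j : ℕ) : ℤ) - ((σ j : ℕ) : ℤ) = 0 := by simpa using h4
  have := h j
  ext
  omega

def ones (m : ℕ) : Fin (m + 1) →₀ ℕ := Finsupp.equivFunOnFinite.symm fun _ => 1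

lemma coeff_RbV (m b : ℕ) (hb : b ≤ 1) (e : Fin (m + 1) →₀ ℕ) (he : e 0 = b) :
    coeff e (Rp (ZMod 2) m ^ b * Vp (ZMod 2) m) =
      if b • ones m ≤ e then coeff (e - b • ones m) (Vp (ZMod 2) m) else 0 := by
  interval_cases b
  · simp
  · have hd : (X 0 : MvPolynomial (Fin (m + 1)) (ZMod 2)) ∣
        ∏ j : Fin m, (X 0 - X j.succ) - ∏ j : Fin m, X j.succ := by
      have := Polynomial.sub_dvd_eval_sub (X 0 : MvPolynomial (Fin (m + 1)) (ZMod 2)) 0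
        (∏ j : Fin m, (Polynomial.X - Polynomial.C (X j.succ)))
      simp only [Polynomial.eval_prod, Polynomial.eval_sub, Polynomial.eval_X,
        Polynomial.eval_C, sub_zero, zero_sub, CharTwo.neg_eq] at this
      exact this
    obtain ⟨Q, hQ⟩ := hd
    have hR : Rp (ZMod 2) m = X 0 * (X 0 * Q) + monomial (ones m) 1 := by
      have h1 : (monomial (ones m) (1 : ZMod 2)) = ∏ i, X i := by
        rw [monomial_eq]
        simp [Finsupp.prod_fintype, ones]
      rw [← hQ, h1, Fin.prod_univ_succ, Rp]; ring
    rw [pow_one, one_smul, hR, add_mul, coeff_add, coeff_monomial_mul', one_mul]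
    have : coeff e (X 0 * (X 0 * Q) * Vp (ZMod 2) m) = 0 := by
      rw [mul_assoc, mul_assoc, coeff_X_mul', coeff_X_mul']
      simp [he]
    rw [this, zero_add]

def tgt (m d : ℕ) : Fin (m + 1) →₀ ℕ :=
  Finsupp.equivFunOnFinite.symm (Fin.cons d fun j : Fin m => d - (j + 1))

@[simp] lemma tgt_zero (m d : ℕ) : tgt m d 0 = d := by simp [tgt]
@[simp] lemma tgt_succ (m d : ℕ) (j : Fin m) : tgt m d j.succ = d - (j + 1) := by simp [tgt]

lemma coeff_sq_mul {n : ℕ} (A B : MvPolynomial (Fin n) (ZMod 2)) (τ : Fin n →₀ ℕ) :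
    coeff τ (A ^ 2 * B) = ∑ μ ∈ A.support,
      if 2 • μ ≤ τ then coeff μ A * coeff (τ - 2 • μ) B else 0 := by
  have : A ^ 2 = ∑ μ ∈ A.support, monomial (2 • μ) (coeff μ A) := by
    rw [← expand_zmod]
    conv_lhs => rw [A.as_sum]
    rw [map_sum]
    refine Finset.sum_congr rfl fun μ _ => ?_
    rw [expand_monomial]
  rw [this, Finset.sum_mul, coeff_sum]
  refine Finset.sum_congr rfl fun μ _ => ?_
  rw [coeff_monomial_mul']

lemma gauss (m : ℕ) : (∑ j : Fin m, ((j : ℕ) + 1)) * 2 = m * (m + 1) := by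
  rw [Fin.sum_univ_eq_sum_range (fun j => j + 1) m]
  induction m with
  | zero => simp
  | succ m ih => rw [Finset.sum_range_succ, add_mul, ih]; ring

theorem main_coeff (m q : ℕ) : ∀ t, 1 ≤ t → t ≤ 2 ^ q → ∀ d, d + t = 2 ^ q * (m + 2) →
    coeff (tgt m d) (Rp (ZMod 2) m ^ (2 ^ (q + 1) - t) * Vp (ZMod 2) m ^ (2 ^ (q + 1) - 1)) = 1 := by
  induction q with
  | zero =>
    intro t h1 h2 d hd
    obtain rfl : t = 1 := by simp at h2; omega
    obtain rfl : d = m + 1 := by simp at hd; omega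
    norm_num
    rw [Rp_mul_Vp]
    have : tgt m (m + 1) = ee id (Fin.revPerm (n := m + 1)) := by
      ext i
      have := ee_apply (id : Fin (m + 1) → _) Function.injective_id (Fin.revPerm (n := m + 1)) i
      rw [id] at this
      rw [this]
      refine Fin.cases ?_ (fun j => ?_) i
      · simp
      · simp [Fin.val_rev]; omega
    rw [this, VV_coeff_ee _ Function.injective_id]
  | succ q ih =>
    intro t h1 h2 d hd
    obtain ⟨t', b, hb, ht⟩ : ∃ t' b, b ≤ 1 ∧ t + b = 2 * t' := by
      rcases Nat.even_or_odd' t with ⟨c, h | h⟩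
      · exact ⟨c, 0, by omega, by omega⟩
      · exact ⟨c + 1, 1, by omega, by omega⟩
    have hp : 2 ^ (q + 1) = 2 * 2 ^ q := by ring
    have hp2 : 2 ^ (q + 1 + 1) = 4 * 2 ^ q := by ring
    have hppos : 1 ≤ 2 ^ q := Nat.one_le_two_pow
    set p := 2 ^ q with hpdef
    rw [hp] at h2 hd ih
    have ht'1 : 1 ≤ t' := by omega
    have ht'2 : t' ≤ p := by omega
    obtain ⟨d', hd'⟩ : ∃ d', d' + t' = p * (m + 2) :=
      ⟨p * (m + 2) - t', by rw [Nat.sub_add_cancel]; nlinarith⟩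
    have hdd : d = 2 * d' + b := by nlinarith
    have hd'm : m + 1 ≤ d' := by nlinarith
    have ihA := ih t' ht'1 ht'2 d' hd'
    set A := Rp (ZMod 2) m ^ (2 * p - t') * Vp (ZMod 2) m ^ (2 * p - 1) with hA
    have hP : Rp (ZMod 2) m ^ (2 ^ (q + 1 + 1) - t) * Vp (ZMod 2) m ^ (2 ^ (q + 1 + 1) - 1) =
        A ^ 2 * (Rp (ZMod 2) m ^ b * Vp (ZMod 2) m) := by
      rw [hp2, show 4 * p - t = (2 * p - t') * 2 + b by omega,
        show 4 * p - 1 = (2 * p - 1) * 2 + 1 by omega, hA]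
      rw [pow_add, pow_add, pow_mul, pow_mul, pow_one]; ring
    rw [hP, coeff_sq_mul]
    -- values of the residual exponent
    have hres0 : ∀ μ : Fin (m + 1) →₀ ℕ, (tgt m d - 2 • μ) 0 = d - 2 * μ 0 := by
      intro μ; simp
    have hresS : ∀ (μ : Fin (m + 1) →₀ ℕ) (j : Fin m),
        (tgt m d - 2 • μ) j.succ = d - (j + 1) - 2 * μ j.succ := by
      intro μ j; simp
    rw [Finset.sum_eq_single (tgt m d')]
    · have hle : 2 • tgt m d' ≤ tgt m d := by
        intro i
        refine Fin.cases ?_ (fun j => ?_) i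
        · simp; omega
        · simp; omega
      rw [if_pos hle, ihA, one_mul, coeff_RbV m b hb _ (by rw [hres0]; simp; omega)]
      have hes : tgt m d - 2 • tgt m d' - b • ones m = ee Fin.succ (Equiv.refl (Fin m)) := by
        ext i
        rw [Finsupp.tsub_apply]
        refine Fin.cases ?_ (fun j => ?_) i
        · rw [ee_apply_of _ _ _ (fun j => Fin.succ_ne_zero j), hres0]
          simp [ones]; omega
        · rw [ee_apply _ (Fin.succ_injective m), hresS]
          simp [ones]; omega
      rw [hes, if_pos, VV_coeff_ee _ (Fin.succ_injective m)]
      intro i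
      refine Fin.cases ?_ (fun j => ?_) i
      · rw [hres0]; simp [ones]; omega
      · rw [hresS]; simp [ones]; omega
    · intro μ hμ hne
      split_ifs with hle
      swap; · rfl
      by_contra hprod
      apply hne
      have hAμ := left_ne_zero_of_mul hprod
      have hBμ := right_ne_zero_of_mul hprod
      have hle0 : 2 * μ 0 ≤ d := by simpa using hle 0
      have hleS : ∀ j : Fin m, 2 * μ j.succ ≤ d - (j + 1) := fun j => by simpa using hle j.succ
      -- divisibility by the variables
      have hpos : ∀ j : Fin m, 1 ≤ (tgt m d - 2 • μ) j.succ := by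
        intro j
        by_contra hc
        apply hBμ
        have : (X j.succ : MvPolynomial (Fin (m + 1)) (ZMod 2)) ∣
            Rp (ZMod 2) m ^ b * Vp (ZMod 2) m :=
          Dvd.dvd.mul_left (Dvd.dvd.mul_right (Finset.dvd_prod_of_mem _ (Finset.mem_univ j)) _) _
        obtain ⟨Q, hQ⟩ := this
        rw [hQ, coeff_X_mul', if_neg]
        rw [Finsupp.mem_support_iff]; omega
      -- distinctness
      have hdist : ∀ a b : Fin m, a ≠ b → μ a.succ ≠ μ b.succ :=
        coeff_distinct (2 * p - t') (2 * p - 1) ⟨p - 1, by omega⟩ μ hAμ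
      -- degree
      have hdeg : μ.degree = (m + 1) * (2 * p - t') +
          (∑ j : Fin m, ((j : ℕ) + 1)) * (2 * p - 1) := by
        by_contra hc
        exact hAμ ((((Rp_homog m).pow _).mul ((Vp_homog m).pow _)).coeff_eq_zero hc)
      have hμ0 : μ 0 ≤ d' := by omega
      have hμS : ∀ j : Fin m, μ j.succ + 1 ≤ d' := by
        intro j
        have h3 := hpos j
        rw [hresS] at h3
        omega
      have hsum : μ 0 + ∑ j : Fin m, μ j.succ = μ.degree := by
        rw [Finsupp.degree_eq_sum, Fin.sum_univ_succ]
      have hdeg2 : μ.degree + (∑ j : Fin m, ((j : ℕ) + 1)) = (m + 1) * d' := by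
        have hg := gauss m
        obtain ⟨c, hc⟩ : ∃ c, 2 * p = t' + c := ⟨2 * p - t', by omega⟩
        obtain ⟨c', hc'⟩ : ∃ c', 2 * p = 1 + c' := ⟨2 * p - 1, by omega⟩
        rw [hdeg]
        rw [show 2 * p - t' = c by omega, show 2 * p - 1 = c' by omega]
        generalize (∑ j : Fin m, ((j : ℕ) + 1)) = g at hg
        zify at *
        have e1 : (c' : ℤ) = 2 * p - 1 := by linarith
        have e2 : (c : ℤ) = 2 * p - t' := by linarith
        have e3 : (d' : ℤ) = p * (m + 2) - t' := by linarith
        rw [e1, e2, e3]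
        linear_combination (p : ℤ) * hg
      have hw : ∑ j : Fin m, (d' - (μ j.succ + 1)) + ∑ j : Fin m, (μ j.succ) + m = m * d' := by
        rw [← Finset.sum_add_distrib]
        have : ∑ j : Fin m, (d' - (μ j.succ + 1) + μ j.succ + 1) = m * d' := by
          rw [Finset.sum_congr rfl (fun j _ => show d' - (μ j.succ + 1) + μ j.succ + 1 = d' by
            have := hμS j; omega)]
          simp
        rw [Finset.sum_add_distrib] at this
        simpa using this
      have hsplit : ∑ j : Fin m, ((j : ℕ) + 1) = ∑ j : Fin m, (j : ℕ) + m := by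
        rw [Finset.sum_add_distrib]; simp
      have hexp : (m + 1) * d' = m * d' + d' := by ring
      obtain ⟨u, hu⟩ := perm_of_sum (fun j : Fin m => d' - (μ j.succ + 1)) (by
        intro a b hab
        by_contra hc
        have h3 := hdist a b hc
        have h4 := hμS a
        have h5 := hμS b
        simp only at hab
        omega) (by omega)
      have hμ0' : μ 0 = d' := by
        have : ∑ j : Fin m, (d' - (μ j.succ + 1)) = ∑ j : Fin m, (j : ℕ) := by
          rw [Finset.sum_congr rfl (fun j _ => hu j)]
          exact Equiv.sum_comp u (fun j : Fin m => (j : ℕ))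
        omega
      rw [coeff_RbV m b hb _ (by rw [hres0]; omega)] at hBμ
      split_ifs at hBμ with hle2
      swap; · exact absurd rfl hBμ
      obtain ⟨σ, hσ⟩ := VV_coeff_ne _ _ hBμ
      have hid := perm_avg u σ (by
        intro j
        have h3 := DFunLike.congr_fun hσ j.succ
        rw [ee_apply _ (Fin.succ_injective m), Finsupp.tsub_apply, hresS] at h3
        have h4 := hle2 j.succ
        rw [hresS] at h4
        simp [ones] at h3 h4
        have h5 := hu j
        have h6 := hμS j
        have h7 := hleS j
        omega)
      ext i
      refine Fin.cases ?_ (fun j => ?_) i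
      · rw [hμ0']; simp
      · have h5 := hu j
        rw [hid j] at h5
        have h6 := hμS j
        simp; omega
    · intro h
      rw [notMem_support_iff] at h
      rw [h]; simp

end algebra

section meas
variable {d : ℕ}

/-- normal vector encoded by `v` -/
def aa (v : Fin (d + 1) → ℝ) : EuclideanSpace ℝ (Fin d) := WithLp.toLp 2 (fun l => v l.succ)

/-- affine functional encoded by `v` -/
def LL (v : Fin (d + 1) → ℝ) (y : EuclideanSpace ℝ (Fin d)) : ℝ := ⟪aa v, y⟫ - v 0

def sgv (v : Fin (d + 1) → ℝ) (y : EuclideanSpace ℝ (Fin d)) : ℝ := Real.sign (LL v y)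

lemma aa_neg (v : Fin (d + 1) → ℝ) : aa (-v) = - aa v := by
  ext l; simp [aa]

lemma LL_neg (v : Fin (d + 1) → ℝ) (y) : LL (-v) y = - LL v y := by
  simp [LL, aa_neg]; ring

lemma sgv_neg (v : Fin (d + 1) → ℝ) (y) : sgv (-v) y = - sgv v y := by
  rw [sgv, LL_neg, Real.sign_neg, sgv]

lemma sgv_abs (v : Fin (d + 1) → ℝ) (y) : |sgv v y| ≤ 1 := by
  rcases Real.sign_apply_eq (LL v y) with h | h | h <;> rw [sgv, h] <;> simp

lemma LL_cont_left (y : EuclideanSpace ℝ (Fin d)) : Continuous fun v => LL v y := by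
  unfold LL aa
  simp only [PiLp.inner_apply]
  fun_prop

lemma LL_cont_right (v : Fin (d + 1) → ℝ) : Continuous fun y => LL v y := by
  unfold LL; fun_prop

lemma sign_meas : Measurable Real.sign := by
  unfold Real.sign
  refine Measurable.ite (measurableSet_lt measurable_id measurable_const) measurable_const ?_
  exact Measurable.ite (measurableSet_lt measurable_const measurable_id) measurable_const
    measurable_const

lemma sgv_meas (v : Fin (d + 1) → ℝ) : Measurable (sgv v) :=
  sign_meas.comp (LL_cont_right v).measurable

lemma sign_contAt {x : ℝ} (hx : x ≠ 0) : ContinuousAt Real.sign x := by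
  rcases lt_or_gt_of_ne hx with h | h
  · refine (continuousAt_const (y := (-1 : ℝ))).congr ?_
    filter_upwards [Iio_mem_nhds h] with z hz
    exact (Real.sign_of_neg hz).symm
  · refine (continuousAt_const (y := (1 : ℝ))).congr ?_
    filter_upwards [Ioi_mem_nhds h] with z hz
    exact (Real.sign_of_pos hz).symm

lemma sgv_contAt (v : Fin (d + 1) → ℝ) (y) (h : LL v y ≠ 0) : ContinuousAt (fun v => sgv v y) v :=
  ContinuousAt.comp (f := fun v => LL v y) (sign_contAt h) (LL_cont_left y).continuousAt

lemma LL_ae {v : Fin (d + 1) → ℝ} (hv : v ≠ 0) {ν : Measure (EuclideanSpace ℝ (Fin d))}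
    (hac : ν ≪ volume) : ∀ᵐ y ∂ν, LL v y ≠ 0 := by
  refine hac.ae_le (?_ : ∀ᵐ y ∂volume, LL v y ≠ 0)
  by_cases ha : aa v = 0
  · have h0 : v 0 ≠ 0 := by
      intro h0
      apply hv
      ext i
      refine Fin.cases h0 (fun l => ?_) i
      have := congrArg (fun z : EuclideanSpace ℝ (Fin d) => z l) ha
      simpa [aa] using this
    refine Filter.Eventually.of_forall fun y => ?_
    simp [LL, ha, h0]
  · rw [ae_iff]
    simp only [not_not]
    let f : EuclideanSpace ℝ (Fin d) →ₗ[ℝ] ℝ := (innerSL ℝ (aa v)).toLinearMap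
    by_cases hne : ∃ y0, LL v y0 = 0
    · obtain ⟨y0, hy0⟩ := hne
      have hk : (LinearMap.ker f) ≠ ⊤ := by
        intro h
        have : aa v ∈ LinearMap.ker f := h ▸ Submodule.mem_top
        apply ha
        simpa [f] using this
      have h1 := Measure.addHaar_submodule (volume : Measure (EuclideanSpace ℝ (Fin d))) _ hk
      have h2 : {y | LL v y = 0} = (fun y => y + (-y0)) ⁻¹' (LinearMap.ker f : Set _) := by
        ext y
        simp only [LL] at hy0
        simp [f, LL, inner_add_right]
        constructor <;> intro h <;> linarith
      rw [h2, measure_preimage_add_right, h1]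
    · push Not at hne
      have : {y | LL v y = 0} = ∅ := by ext y; simp [hne y]
      rw [this]; simp

lemma sgv_sq {v : Fin (d + 1) → ℝ} {y} (h : LL v y ≠ 0) : sgv v y = 1 ∨ sgv v y = -1 := by
  rcases lt_or_gt_of_ne h with h | h
  · right; exact Real.sign_of_neg h
  · left; exact Real.sign_of_pos h

variable {k : ℕ}

def FF (ν : Measure (EuclideanSpace ℝ (Fin d))) (i : Fin k) (x : Pt k d) : ℝ :=
  ∫ y, sgv (x i) y ∂ν

def GG (ν : Measure (EuclideanSpace ℝ (Fin d))) (i j : Fin k) (x : Pt k d) : ℝ :=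
  ∫ y, sgv (x i) y * sgv (x j) y ∂ν

lemma FF_cont (ν : Measure (EuclideanSpace ℝ (Fin d))) [IsFiniteMeasure ν] (hac : ν ≪ volume)
    (i : Fin k) (x : Pt k d) (hx : x ∈ good k d) : ContinuousAt (FF ν i) x := by
  refine continuousAt_of_dominated (bound := fun _ => 1) ?_ ?_ (integrable_const _) ?_
  · exact Filter.Eventually.of_forall fun z => (sgv_meas _).aestronglyMeasurable
  · exact Filter.Eventually.of_forall fun z => Filter.Eventually.of_forall fun y => sgv_abs _ _
  · filter_upwards [LL_ae (hx i) hac] with y hy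
    exact ContinuousAt.comp (f := fun z : Pt k d => z i) (g := fun v => sgv v y)
      (sgv_contAt _ _ hy) (continuous_apply i).continuousAt

lemma GG_cont (ν : Measure (EuclideanSpace ℝ (Fin d))) [IsFiniteMeasure ν] (hac : ν ≪ volume)
    (i j : Fin k) (x : Pt k d) (hx : x ∈ good k d) : ContinuousAt (GG ν i j) x := by
  refine continuousAt_of_dominated (bound := fun _ => 1) ?_ ?_ (integrable_const _) ?_
  · exact Filter.Eventually.of_forall fun z =>
      ((sgv_meas _).mul (sgv_meas _)).aestronglyMeasurable
  · refine Filter.Eventually.of_forall fun z => Filter.Eventually.of_forall fun y => ?_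
    rw [Real.norm_eq_abs, abs_mul]
    exact mul_le_one₀ (sgv_abs _ _) (abs_nonneg _) (sgv_abs _ _)
  · filter_upwards [LL_ae (hx i) hac, LL_ae (hx j) hac] with y hy hy'
    exact (ContinuousAt.comp (f := fun z : Pt k d => z i) (g := fun v => sgv v y)
      (sgv_contAt _ _ hy) (continuous_apply i).continuousAt).mul
      (ContinuousAt.comp (f := fun z : Pt k d => z j) (g := fun v => sgv v y)
      (sgv_contAt _ _ hy') (continuous_apply j).continuousAt)

lemma T_same (i : Fin k) (x : Pt k d) : T i x i = - x i := by simp [T]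
lemma T_ne {i l : Fin k} (h : l ≠ i) (x : Pt k d) : T i x l = x l := by simp [T, h]

lemma FF_T (ν : Measure (EuclideanSpace ℝ (Fin d))) (i : Fin k) (x : Pt k d) (l : Fin k) :
    FF ν i (T l x) = if (Pi.single i (1 : ZMod 2) : Fin k → ZMod 2) l = 0 then FF ν i x
      else - FF ν i x := by
  by_cases h : l = i
  · subst h
    simp [FF, T_same, sgv_neg, integral_neg]
  · simp [FF, T_ne (Ne.symm h), h]

lemma GG_T (ν : Measure (EuclideanSpace ℝ (Fin d))) (i j : Fin k) (hij : i ≠ j) (x : Pt k d)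
    (l : Fin k) :
    GG ν i j (T l x) = if (Pi.single i (1 : ZMod 2) + Pi.single j 1 : Fin k → ZMod 2) l = 0
      then GG ν i j x else - GG ν i j x := by
  by_cases h : l = i
  · subst h
    simp [GG, T_same, T_ne hij.symm, sgv_neg, integral_neg, hij]
  · by_cases h' : l = j
    · subst h'
      simp [GG, T_same, T_ne hij, sgv_neg, integral_neg, h]
    · simp [GG, T_ne (Ne.symm h), T_ne (Ne.symm h'), h, h']

lemma lin_single (i : Fin k) : lin (Pi.single i (1 : ZMod 2)) = MvPolynomial.X i := by
  unfold lin
  rw [Finset.sum_eq_single i]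
  · simp
  · intro j _ hj; simp [hj]
  · simp

lemma lin_add (α β : Fin k → ZMod 2) : lin (α + β) = lin α + lin β := by
  simp [lin, add_mul, Finset.sum_add_distrib]

lemma prod_count {R : Type*} [CommMonoid R] (N M : ℕ) (h : M ≤ N) (P : Prop) [Decidable P] (c : R) :
    (∏ r : Fin N, if P ∨ (r : ℕ) < M then c else 1) = c ^ (if P then N else M) := by
  by_cases hP : P
  · simp [hP]
  · simp only [hP, false_or, if_false]
    rw [Fin.prod_univ_eq_prod_range (fun r => if r < M then c else 1) N, ← Finset.prod_filter,
      Finset.prod_const]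
    congr 1
    have : Finset.filter (fun r => r < M) (Finset.range N) = Finset.range M := by
      ext r; simp; omega
    rw [this]; simp

open MvPolynomial in
lemma prod_eq (m N M : ℕ) (h : M ≤ N) :
    (∏ p ∈ (Finset.univ : Finset (Fin (m + 1) × Fin N)).filter
        (fun p => p.1 ≠ 0 ∨ (p.2 : ℕ) < M), (X p.1 : MvPolynomial (Fin (m + 1)) (ZMod 2))) *
      (∏ p ∈ (Finset.univ : Finset (Fin (m + 1) × Fin (m + 1) × Fin N)).filter
        (fun p => p.1 < p.2.1 ∧ (p.1 ≠ 0 ∨ (p.2.2 : ℕ) < M)), (X p.1 + X p.2.1)) =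
      Rp (ZMod 2) m ^ M * Vp (ZMod 2) m ^ N := by
  rw [Finset.prod_filter, Finset.prod_filter, Fintype.prod_prod_type, Fintype.prod_prod_type]
  simp only [Fintype.prod_prod_type]
  have h2 : ∀ i j : Fin (m + 1), (∏ r : Fin N, if i < j ∧ (i ≠ 0 ∨ (r : ℕ) < M) then
      (X i + X j : MvPolynomial (Fin (m + 1)) (ZMod 2)) else 1) =
      if i < j then (X j - X i) ^ (if i ≠ 0 then N else M) else 1 := by
    intro i j
    by_cases hij : i < j
    · simp only [hij, true_and, if_true]
      rw [prod_count N M h, CharTwo.sub_eq_add, add_comm (X j)]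
    · simp [hij]
  simp only [h2]
  simp only [prod_count N M h]
  simp only [← Finset.prod_filter]
  have h3 : ∀ i : Fin (m + 1), Finset.univ.filter (fun j => i < j) = Finset.Ioi i := by
    intro i; ext j; simp
  simp only [h3]
  rw [Fin.prod_univ_succ]
  rw [Fin.prod_univ_succ (fun i : Fin (m + 1) => ∏ j ∈ Finset.Ioi i,
    (X j - X i : MvPolynomial (Fin (m + 1)) (ZMod 2)) ^ (if i ≠ 0 then N else M))]
  rw [Fin.prod_Ioi_zero]
  simp only [Fin.prod_Ioi_succ]
  simp only [ne_eq, not_true, if_false, Fin.succ_ne_zero, not_false_iff, if_true]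
  simp only [Finset.prod_pow]
  have : Rp (ZMod 2) m = X 0 * ∏ j : Fin m, (X j.succ - X 0) := by
    unfold Rp
    congr 1
    refine Finset.prod_congr rfl fun j _ => ?_
    rw [← neg_sub, CharTwo.neg_eq]
  rw [this]
  simp only [Vp, VV, mul_pow]
  ring

lemma core (m d N M : ℕ) (hMN : M ≤ N)
    (hco : MvPolynomial.coeff (tgt m d) (Rp (ZMod 2) m ^ M * Vp (ZMod 2) m ^ N) = 1)
    (μ : Fin N → Measure (EuclideanSpace ℝ (Fin d)))
    (hfin : ∀ r, IsFiniteMeasure (μ r)) (hac : ∀ r, μ r ≪ volume) :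
    ∃ x ∈ good (m + 1) d,
      (∀ i (r : Fin N), (i ≠ 0 ∨ (r : ℕ) < M) → FF (μ r) i x = 0) ∧
      (∀ i j (r : Fin N), i < j → (i ≠ 0 ∨ (r : ℕ) < M) → GG (μ r) i j x = 0) := by
  let U1 := (Finset.univ : Finset (Fin (m + 1) × Fin N)).filter (fun p => p.1 ≠ 0 ∨ (p.2 : ℕ) < M)
  let U2 := (Finset.univ : Finset (Fin (m + 1) × Fin (m + 1) × Fin N)).filter
        (fun p => p.1 < p.2.1 ∧ (p.1 ≠ 0 ∨ (p.2.2 : ℕ) < M))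
  let f1 : Fin (m + 1) × Fin N → (Pt (m + 1) d → ℝ) × (Fin (m + 1) → ZMod 2) :=
    fun p => (FF (μ p.2) p.1, Pi.single p.1 1)
  let f2 : Fin (m + 1) × Fin (m + 1) × Fin N → (Pt (m + 1) d → ℝ) × (Fin (m + 1) → ZMod 2) :=
    fun p => (GG (μ p.2.2) p.1 p.2.1, Pi.single p.1 1 + Pi.single p.2.1 1)
  have hmem : ∀ p, p ∈ U1.toList.map f1 ++ U2.toList.map f2 ↔
      (∃ u ∈ U1, f1 u = p) ∨ (∃ u ∈ U2, f2 u = p) := by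
    intro p; simp only [List.mem_append, List.mem_map, Finset.mem_toList]
  obtain ⟨x, hx, h⟩ := borsuk_ulam_prod (k := m + 1) (D := d)
    (U1.toList.map f1 ++ U2.toList.map f2) (by
      intro p hp x hx
      rcases (hmem p).1 hp with ⟨u, hu, rfl⟩ | ⟨u, hu, rfl⟩
      · exact FF_cont _ (hac _) _ x hx
      · exact GG_cont _ (hac _) _ _ x hx) (by
      intro p hp x hx i
      rcases (hmem p).1 hp with ⟨u, hu, rfl⟩ | ⟨u, hu, rfl⟩
      · exact FF_T _ _ _ _
      · refine GG_T _ _ _ ?_ _ _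
        exact ne_of_lt (Finset.mem_filter.1 hu).2.1) (tgt m d) (by
      intro i
      refine Fin.cases ?_ (fun j => ?_) i
      · simp
      · simp) (by
      rw [List.map_append, List.prod_append, List.map_map, List.map_map, Finset.prod_map_toList,
        Finset.prod_map_toList]
      simp only [f1, f2, Function.comp_def, lin_add, lin_single]
      rw [prod_eq m N M hMN, hco]
      exact one_ne_zero)
  refine ⟨x, hx, fun i r hr => ?_, fun i j r hij hr => ?_⟩
  · exact h (f1 (i, r)) ((hmem _).2 (Or.inl ⟨(i, r), by simp only [U1, Finset.mem_filter, Finset.mem_univ, true_and]; exact hr, rfl⟩))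
  · exact h (f2 (i, j, r)) ((hmem _).2 (Or.inr ⟨(i, j, r), by simp only [U2, Finset.mem_filter, Finset.mem_univ, true_and]; exact ⟨hij, hr⟩, rfl⟩))

lemma aa_ne (ν : Measure (EuclideanSpace ℝ (Fin d))) [IsFiniteMeasure ν] (hν : ν ≠ 0)
    (v : Fin (d + 1) → ℝ) (hv : v ≠ 0) (h : ∫ y, sgv v y ∂ν = 0) : aa v ≠ 0 := by
  intro ha
  have h0 : v 0 ≠ 0 := by
    intro h0
    apply hv
    ext i
    refine Fin.cases h0 (fun l => ?_) i
    have := congrArg (fun z : EuclideanSpace ℝ (Fin d) => z l) ha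
    simpa [aa] using this
  have h1 : ∀ y, sgv v y = Real.sign (- v 0) := by
    intro y; simp [sgv, LL, ha]
  simp only [h1, integral_const, smul_eq_mul, mul_eq_zero] at h
  rcases h with h | h
  · rw [measureReal_eq_zero_iff] at h
    exact hν (Measure.measure_univ_eq_zero.1 h)
  · rw [Real.sign_eq_zero_iff] at h
    exact h0 (by linarith)

lemma sgv_int (ν : Measure (EuclideanSpace ℝ (Fin d))) [IsFiniteMeasure ν]
    (v : Fin (d + 1) → ℝ) : Integrable (sgv v) ν :=
  Integrable.of_bound (sgv_meas v).aestronglyMeasurable 1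
    (Filter.Eventually.of_forall fun y => sgv_abs v y)

lemma sgv_int2 (ν : Measure (EuclideanSpace ℝ (Fin d))) [IsFiniteMeasure ν]
    (v w : Fin (d + 1) → ℝ) : Integrable (fun y => sgv v y * sgv w y) ν :=
  Integrable.of_bound ((sgv_meas v).mul (sgv_meas w)).aestronglyMeasurable 1
    (Filter.Eventually.of_forall fun y => by
      rw [Real.norm_eq_abs, abs_mul]
      exact mul_le_one₀ (sgv_abs _ _) (abs_nonneg _) (sgv_abs _ _))

def bs (ε : Bool) : ℝ := if ε then 1 else -1

lemma mem_half (v : Fin (d + 1) → ℝ) (ε : Bool) (y) (h : LL v y ≠ 0) :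
    (halfSpace (aa v) (v 0) ε).indicator (fun _ => (1 : ℝ)) y = (1 + bs ε * sgv v y) / 2 := by
  have hLL : LL v y = ⟪aa v, y⟫ - v 0 := rfl
  rcases lt_or_gt_of_ne h with h | h
  · have hs : sgv v y = -1 := Real.sign_of_neg h
    rw [hs]
    cases ε
    · rw [Set.indicator_of_mem]
      · norm_num [bs]
      · simp [halfSpace]; linarith
    · rw [Set.indicator_of_notMem]
      · norm_num [bs]
      · simp [halfSpace]; linarith
  · have hs : sgv v y = 1 := Real.sign_of_pos h
    rw [hs]
    cases ε
    · rw [Set.indicator_of_notMem]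
      · norm_num [bs]
      · simp [halfSpace]; linarith
    · rw [Set.indicator_of_mem]
      · norm_num [bs]
      · simp [halfSpace]; linarith

lemma half_meas (a : EuclideanSpace ℝ (Fin d)) (b : ℝ) (ε : Bool) :
    MeasurableSet (halfSpace a b ε) := by
  cases ε
  · simp only [halfSpace]
    exact measurableSet_le (by fun_prop) (by fun_prop)
  · simp only [halfSpace, if_true]
    exact measurableSet_le (by fun_prop) (by fun_prop)

lemma quarter (ν : Measure (EuclideanSpace ℝ (Fin d))) [IsFiniteMeasure ν] (hac : ν ≪ volume)
    (v w : Fin (d + 1) → ℝ) (hv : v ≠ 0) (hw : w ≠ 0)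
    (h1 : ∫ y, sgv v y ∂ν = 0) (h2 : ∫ y, sgv w y ∂ν = 0) (h3 : ∫ y, sgv v y * sgv w y ∂ν = 0)
    (ε δ : Bool) :
    ν (halfSpace (aa v) (v 0) ε ∩ halfSpace (aa w) (w 0) δ) = ν Set.univ / 2 ^ 2 := by
  set R := halfSpace (aa v) (v 0) ε ∩ halfSpace (aa w) (w 0) δ with hR
  have hRm : MeasurableSet R := (half_meas _ _ _).inter (half_meas _ _ _)
  have e1 : ν.real R = ∫ y, R.indicator (fun _ => (1 : ℝ)) y ∂ν := by
    rw [integral_indicator hRm]; simp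
  have e2 : ∫ y, R.indicator (fun _ => (1 : ℝ)) y ∂ν =
      ∫ y, (1 / 4 + (bs ε / 4) * sgv v y + (bs δ / 4) * sgv w y +
        (bs ε * bs δ / 4) * (sgv v y * sgv w y)) ∂ν := by
    refine integral_congr_ae ?_
    filter_upwards [LL_ae hv hac, LL_ae hw hac] with y hy hy'
    have : R.indicator (fun _ => (1 : ℝ)) y =
        (halfSpace (aa v) (v 0) ε).indicator (fun _ => (1 : ℝ)) y *
        (halfSpace (aa w) (w 0) δ).indicator (fun _ => (1 : ℝ)) y := by
      rw [hR, ← Set.inter_indicator_mul]; simp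
    rw [this, mem_half _ _ _ hy, mem_half _ _ _ hy']
    ring
  have e3 : ν.real R = ν.real Set.univ / 4 := by
    rw [e1, e2, integral_add, integral_add, integral_add, integral_const_mul, integral_const_mul,
      integral_const_mul, h1, h2, h3]
    · simp; ring
    · exact integrable_const _
    · exact (sgv_int ν v).const_mul _
    · exact (integrable_const _).add ((sgv_int ν v).const_mul _)
    · exact (sgv_int ν w).const_mul _
    · exact ((integrable_const _).add ((sgv_int ν v).const_mul _)).add ((sgv_int ν w).const_mul _)
    · exact (sgv_int2 ν v w).const_mul _
  rw [← ofReal_measureReal (μ := ν) (s := R), e3, ENNReal.ofReal_div_of_pos (by norm_num),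
    ofReal_measureReal]
  norm_num

lemma quarter_region {k : ℕ} (ν : Measure (EuclideanSpace ℝ (Fin d))) [IsFiniteMeasure ν]
    (hac : ν ≪ volume) (x : Pt k d) (hx : x ∈ good k d) (s : Finset (Fin k)) (hs : s.card = 2)
    (h1 : ∀ i ∈ s, FF ν i x = 0) (h2 : ∀ i ∈ s, ∀ j, i < j → GG ν i j x = 0)
    (ε : Fin k → Bool) :
    ν (region (fun i => aa (x i)) (fun i => x i 0) s ε) = ν Set.univ / 2 ^ 2 := by
  obtain ⟨i, j, hij, rfl⟩ := Finset.card_eq_two.1 hs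
  have hG : ∫ y, sgv (x i) y * sgv (x j) y ∂ν = 0 := by
    rcases lt_or_gt_of_ne hij with h | h
    · exact h2 i (by simp) j h
    · have := h2 j (by simp) i h
      rw [GG] at this
      rw [← this]
      simp only [mul_comm]
  have := quarter ν hac (x i) (x j) (hx i) (hx j) (h1 i (by simp)) (h1 j (by simp)) hG (ε i) (ε j)
  rw [← this]
  congr 1
  ext y
  simp [region]

end meas

end PairEquip

theorem stmt_6 (k q t : ℕ) (hk : 2 ≤ k) (ht1 : 1 ≤ t) (ht2 : t ≤ 2 ^ q)
    (d : ℕ) (hd : d = 2 ^ q * (k + 1) - t)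
    (μ : Fin (2 ^ (q + 1) - 1) → Measure (EuclideanSpace ℝ (Fin d)))
    (hfin : ∀ r, IsFiniteMeasure (μ r))
    (hac : ∀ r, μ r ≪ volume) :
    ∃ (a : Fin k → EuclideanSpace ℝ (Fin d)) (b : Fin k → ℝ),
      (∀ i, a i ≠ 0) ∧
      -- (i) any two of H₁, …, H_k equipartition the first 2^(q+1) - t masses
      (∀ r : Fin (2 ^ (q + 1) - 1), (r : ℕ) < 2 ^ (q + 1) - t →
        ∀ s : Finset (Fin k), s.card = 2 → ∀ ε : Fin k → Bool,
          μ r (region a b s ε) = μ r Set.univ / 2 ^ 2) ∧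
      -- (ii) any two of H₂, …, H_k equipartition the remaining t - 1 masses
      (∀ r : Fin (2 ^ (q + 1) - 1), 2 ^ (q + 1) - t ≤ (r : ℕ) →
        ∀ s : Finset (Fin k), s.card = 2 → (∀ i ∈ s, (i : ℕ) ≠ 0) →
          ∀ ε : Fin k → Bool,
            μ r (region a b s ε) = μ r Set.univ / 2 ^ 2) := by
  classical
  obtain ⟨m, rfl⟩ : ∃ m, k = m + 1 := ⟨k - 1, by omega⟩
  have hp : 2 ^ (q + 1) = 2 * 2 ^ q := by ring
  have hp1 : 1 ≤ 2 ^ q := Nat.one_le_two_pow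
  have hdt : d + t = 2 ^ q * (m + 2) := by
    rw [hd, Nat.sub_add_cancel]
    nlinarith
  have hco := PairEquip.main_coeff m q t ht1 ht2 d hdt
  let B : Measure (EuclideanSpace ℝ (Fin d)) := volume.restrict (Metric.ball 0 1)
  have hBfin : IsFiniteMeasure B := ⟨by
    simp only [B, Measure.restrict_apply_univ]
    exact measure_ball_lt_top⟩
  have hB0 : B ≠ 0 := by
    intro h
    have h1 : B Set.univ = 0 := by rw [h]; simp
    simp only [B, Measure.restrict_apply_univ] at h1
    exact (Metric.measure_ball_pos volume (0 : EuclideanSpace ℝ (Fin d)) one_pos).ne' h1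
  let μ' : Fin (2 ^ (q + 1) - 1) → Measure (EuclideanSpace ℝ (Fin d)) :=
    fun r => if μ r = 0 then B else μ r
  have hμfin : ∀ r, IsFiniteMeasure (μ' r) := by
    intro r
    simp only [μ']
    split_ifs
    · exact hBfin
    · exact hfin r
  have hμac : ∀ r, μ' r ≪ volume := by
    intro r
    simp only [μ']
    split_ifs
    · exact Measure.absolutelyContinuous_of_le Measure.restrict_le_self
    · exact hac r
  have hμ0 : ∀ r, μ' r ≠ 0 := by
    intro r
    simp only [μ']
    split_ifs with h
    · exact hB0
    · exact h
  obtain ⟨x, hx, hF, hG⟩ := PairEquip.core m d (2 ^ (q + 1) - 1) (2 ^ (q + 1) - t) (by omega) hco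
    μ' hμfin hμac
  have key : ∀ (r : Fin (2 ^ (q + 1) - 1)) (s : Finset (Fin (m + 1))), s.card = 2 →
      (∀ i ∈ s, i ≠ 0 ∨ (r : ℕ) < 2 ^ (q + 1) - t) → ∀ ε : Fin (m + 1) → Bool,
      μ r (region (fun i => PairEquip.aa (x i)) (fun i => x i 0) s ε) = μ r Set.univ / 2 ^ 2 := by
    intro r s hs h ε
    by_cases h0 : μ r = 0
    · rw [h0]; simp
    · have he : μ' r = μ r := by simp [μ', h0]
      rw [← he]
      have := hμfin r
      exact PairEquip.quarter_region (μ' r) (hμac r) x hx s hs (fun i hi => hF i r (h i hi))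
        (fun i hi j hij => hG i j r hij (h i hi)) ε
  refine ⟨fun i => PairEquip.aa (x i), fun i => x i 0, fun i => ?_, ?_, ?_⟩
  · have hr : 0 < 2 ^ (q + 1) - 1 := by omega
    have := hμfin ⟨0, hr⟩
    refine PairEquip.aa_ne (μ' ⟨0, hr⟩) (hμ0 _) (x i) (hx i) (hF i ⟨0, hr⟩ (Or.inr ?_))
    simp only
    omega
  · intro r hr s hs ε
    exact key r s hs (fun i _ => Or.inr hr) ε
  · intro r _ s hs h0 ε
    refine key r s hs (fun i hi => Or.inl ?_) ε
    intro h
    exact h0 i hi (by rw [h]; rfl)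
end
end
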